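/- arXiv:2010.07902 — 2 statements merged into one kernel-verified Lean document; each statement's English description precedes it below -/
import Mathlib

section
/- Qubit-ebit Singleton bound, dimension inequality. Let 2 ≤ d ≤ n, q ≥ 2, K ≥ 1, and let ψ be a pure quantum state on R ⊗ A_f ⊗ X_1 ⊗ … ⊗ X_n ⊗ B_in, where R has dimension K, each X_i has dimension q, the marginal of ψ on R is the maximally mixed state (1/K)·Id_K, and the marginal of ψ on R ⊗ B_in is the tensor product of its marginals on R and on B_in. Suppose that for every partition {1,…,n} = I ∪ J with |I| = n−d+1 and |J| = d−1, S(X_I B_in)_ψ = S(R)_ψ + S(A_f)_ψ + S(X_J)_ψ. Then log K ≤ (n−d+1)·σ̿ ≤ (n−d+1)·log q, where σ̿ := (1/(n−d+1))·E_{|I|=n−d+1} S(X_I)_ψ; and if moreover 2(d−1) < n, then also log K ≤ (n−d+1)·σ̄, where σ̄ := (1/(d−1))·E_{|J|=d−1} S(X_J)_ψ. -/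
open scoped BigOperators ComplexOrder

/-- Von Neumann entropy of a matrix: `-∑ λ_j log λ_j` over the eigenvalues,
if the matrix is Hermitian (else junk value 0). Natural logarithm,
with the convention `0 * log 0 = 0` (automatic since `Real.log 0 = 0`). -/
noncomputable def vnEntropy {m : Type*} [Fintype m] [DecidableEq m]
    (ρ : Matrix m m ℂ) : ℝ :=
  if h : ρ.IsHermitian then
    -∑ j, h.eigenvalues j * Real.log (h.eigenvalues j)
  else 0

/-- Marginal (partial trace) of a state on the composite system
`⨂_{i : ι} X_i` (with `X_i = ℂ^{dim i}`), keeping the factors in `S`. -/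
noncomputable def marginal {ι : Type*} [Fintype ι] [DecidableEq ι]
    {dim : ι → ℕ}
    (ρ : Matrix ((i : ι) → Fin (dim i)) ((i : ι) → Fin (dim i)) ℂ)
    (S : Finset ι) :
    Matrix ((i : {j : ι // j ∈ S}) → Fin (dim i.1))
           ((i : {j : ι // j ∈ S}) → Fin (dim i.1)) ℂ :=
  fun x y =>
    ∑ z : (i : {j : ι // j ∉ S}) → Fin (dim i.1),
      ρ (fun i => if h : i ∈ S then x ⟨i, h⟩ else z ⟨i, h⟩)
        (fun i => if h : i ∈ S then y ⟨i, h⟩ else z ⟨i, h⟩)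

/-- Entropy of the marginal of `ρ` on the factors in `S`. -/
noncomputable def mEnt {ι : Type*} [Fintype ι] [DecidableEq ι]
    {dim : ι → ℕ}
    (ρ : Matrix ((i : ι) → Fin (dim i)) ((i : ι) → Fin (dim i)) ℂ)
    (S : Finset ι) : ℝ :=
  vnEntropy (marginal ρ S)


/-- Restriction of a composite index along a subset inclusion. -/
def restInd {ι : Type*} [DecidableEq ι] {dim : ι → ℕ} {S T : Finset ι} (h : S ⊆ T)
    (x : (i : {j : ι // j ∈ T}) → Fin (dim i.1)) :
    (i : {j : ι // j ∈ S}) → Fin (dim i.1) :=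
  fun i => x ⟨i.1, h i.2⟩

open Matrix

section EntropyBasics

noncomputable def rootEnt {m : Type*} [Fintype m] [DecidableEq m] (ρ : Matrix m m ℂ) : ℝ :=
  (ρ.charpoly.roots.map (fun z => Real.negMulLog z.re)).sum

theorem vn_eq_rootEnt {m : Type*} [Fintype m] [DecidableEq m] (ρ : Matrix m m ℂ)
    (h : ρ.IsHermitian) : vnEntropy ρ = rootEnt ρ := by
  unfold vnEntropy rootEnt
  rw [dif_pos h, h.roots_charpoly_eq_eigenvalues, Multiset.map_map]
  simp [Real.negMulLog]

theorem vn_eq_sum {m : Type*} [Fintype m] [DecidableEq m] (ρ : Matrix m m ℂ)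
    (h : ρ.IsHermitian) : vnEntropy ρ = ∑ j, Real.negMulLog (h.eigenvalues j) := by
  unfold vnEntropy
  rw [dif_pos h]
  simp [Real.negMulLog]

theorem exists_diag {m : Type*} [Fintype m] [DecidableEq m] (ρ : Matrix m m ℂ)
    (h : ρ.IsHermitian) : ∃ U : Matrix m m ℂ, Uᴴ * U = 1 ∧ U * Uᴴ = 1 ∧
      ρ = U * diagonal (fun j => (h.eigenvalues j : ℂ)) * Uᴴ := by
  refine ⟨h.eigenvectorUnitary, ?_, ?_, ?_⟩
  · exact Unitary.coe_star_mul_self h.eigenvectorUnitary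
  · exact Unitary.coe_mul_star_self h.eigenvectorUnitary
  · exact h.spectral_theorem

theorem diag_herm {m : Type*} [Fintype m] [DecidableEq m] {ρ U : Matrix m m ℂ} {p : m → ℝ}
    (hρ : ρ = U * diagonal (fun j => (p j : ℂ)) * Uᴴ) : ρ.IsHermitian := by
  rw [hρ]
  apply isHermitian_mul_mul_conjTranspose
  rw [IsHermitian, diagonal_conjTranspose]
  congr 1; ext j; simp

theorem vn_of_diag {m : Type*} [Fintype m] [DecidableEq m] {ρ U : Matrix m m ℂ} {p : m → ℝ}
    (hU : Uᴴ * U = 1) (hρ : ρ = U * diagonal (fun j => (p j : ℂ)) * Uᴴ) :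
    vnEntropy ρ = ∑ j, Real.negMulLog (p j) := by
  rw [vn_eq_rootEnt _ (diag_herm hρ), rootEnt, hρ, charpoly_mul_comm, ← mul_assoc, hU, one_mul,
    charpoly_diagonal, Polynomial.roots_prod]
  · simp
  · exact Finset.prod_ne_zero_iff.2 fun i _ => Polynomial.X_sub_C_ne_zero _

theorem vn_reindex {m k : Type*} [Fintype m] [DecidableEq m] [Fintype k] [DecidableEq k]
    (ρ : Matrix m m ℂ) (h : ρ.IsHermitian) (e : k ≃ m) :
    vnEntropy (ρ.submatrix e e) = vnEntropy ρ := by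
  rw [vn_eq_rootEnt _ h, vn_eq_rootEnt _ (h.submatrix e), rootEnt, rootEnt]
  have := charpoly_reindex e.symm ρ
  rw [reindex_apply, Equiv.symm_symm] at this
  rw [this]

theorem vn_transpose {m : Type*} [Fintype m] [DecidableEq m]
    (ρ : Matrix m m ℂ) (h : ρ.IsHermitian) :
    vnEntropy ρᵀ = vnEntropy ρ := by
  rw [vn_eq_rootEnt _ h, vn_eq_rootEnt _ h.transpose, rootEnt, rootEnt, charpoly_transpose]

theorem vn_mul_comm {m k : Type*} [Fintype m] [DecidableEq m] [Fintype k] [DecidableEq k]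
    (M : Matrix m k ℂ) : vnEntropy (M * Mᴴ) = vnEntropy (Mᴴ * M) := by
  rw [vn_eq_rootEnt _ (isHermitian_mul_conjTranspose_self M),
    vn_eq_rootEnt _ (isHermitian_conjTranspose_mul_self M), rootEnt, rootEnt]
  have h := congrArg Polynomial.roots (charpoly_mul_comm' M Mᴴ)
  have hX : ∀ j : ℕ, (Polynomial.X : Polynomial ℂ) ^ j ≠ 0 := fun j =>
    pow_ne_zero _ Polynomial.X_ne_zero
  rw [Polynomial.roots_mul (mul_ne_zero (hX _) (charpoly_monic _).ne_zero),
    Polynomial.roots_mul (mul_ne_zero (hX _) (charpoly_monic _).ne_zero)] at h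
  have h2 := congrArg (fun s => (s.map (fun z : ℂ => Real.negMulLog z.re)).sum) h
  simpa [Multiset.map_nsmul, Multiset.sum_nsmul] using h2

theorem eig_sum {m : Type*} [Fintype m] [DecidableEq m] (ρ : Matrix m m ℂ)
    (h : ρ.IsHermitian) (ht : ρ.trace = 1) : ∑ j, h.eigenvalues j = 1 := by
  have := h.trace_eq_sum_eigenvalues
  rw [ht] at this
  apply Complex.ofReal_injective
  push_cast
  simpa using this.symm

theorem vn_nonneg {m : Type*} [Fintype m] [DecidableEq m] (ρ : Matrix m m ℂ)
    (h : ρ.PosSemidef) (ht : ρ.trace = 1) : 0 ≤ vnEntropy ρ := by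
  rw [vn_eq_sum _ h.1]
  refine Finset.sum_nonneg fun j _ => Real.negMulLog_nonneg (h.eigenvalues_nonneg j) ?_
  rw [← eig_sum ρ h.1 ht]
  exact Finset.single_le_sum (fun i _ => h.eigenvalues_nonneg i) (Finset.mem_univ j)

theorem vn_le_log {m : Type*} [Fintype m] [DecidableEq m] (ρ : Matrix m m ℂ)
    (h : ρ.PosSemidef) (ht : ρ.trace = 1) : vnEntropy ρ ≤ Real.log (Fintype.card m) := by
  rw [vn_eq_sum _ h.1]
  have hs := eig_sum ρ h.1 ht
  have hne : Nonempty m := by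
    by_contra hne
    rw [not_nonempty_iff] at hne
    simp at hs
  have hc : (0 : ℝ) < Fintype.card m := by exact_mod_cast Fintype.card_pos
  have := Real.concaveOn_negMulLog.le_map_sum (t := Finset.univ) (w := fun _ : m => (1 : ℝ) / Fintype.card m)
    (p := h.1.eigenvalues) (fun i _ => by positivity) (by simp [hc.ne'])
    (fun i _ => h.eigenvalues_nonneg i)
  simp only [smul_eq_mul] at this
  rw [← Finset.mul_sum, ← Finset.mul_sum, hs, mul_one] at this
  simp only [Real.negMulLog] at this ⊢
  rw [one_div, Real.log_inv, neg_mul_neg] at this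
  exact le_of_mul_le_mul_left this (by positivity)

end EntropyBasics

section DPI

theorem log_deriv_aux {κ : Type*} [Fintype κ] (c r : κ → ℝ) (hr : ∀ i, c i ≠ 0 → 0 < r i) (t : ℝ)
    (ht : 0 ≤ t) :
    HasDerivAt (fun t => ∑ i, c i * Real.log (r i + t)) (∑ i, c i / (r i + t)) t := by
  refine HasDerivAt.fun_sum fun i _ => ?_
  by_cases hc : c i = 0
  · simpa [hc] using hasDerivAt_const t (0 : ℝ)
  · have := ((hasDerivAt_id t).const_add (r i)).log (by have := hr i hc; simp; linarith)
    have h2 := this.const_mul (c i)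
    simp only [id, mul_one_div] at h2
    exact h2

theorem log_lim_aux {κ : Type*} [Fintype κ] (c r : κ → ℝ) :
    Filter.Tendsto (fun t => ∑ i, c i * Real.log (r i + t) - (∑ i, c i) * Real.log t)
      Filter.atTop (nhds 0) := by
  have : ∀ i ∈ Finset.univ, Filter.Tendsto (fun t => c i * (Real.log (t + r i) - Real.log t))
      Filter.atTop (nhds (c i * 0)) := fun i _ =>
    (Real.tendsto_log_comp_add_sub_log (r i)).const_mul (c i)
  have := tendsto_finsetSum _ this
  simp only [mul_zero, Finset.sum_const_zero] at this
  refine this.congr fun t => ?_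
  rw [Finset.sum_mul, ← Finset.sum_sub_distrib]
  exact Finset.sum_congr rfl fun i _ => by rw [add_comm t]; ring

theorem log_compare {ι κ : Type*} [Fintype ι] [Fintype κ] (c r : ι → ℝ) (c' r' : κ → ℝ)
    (hr : ∀ i, c i ≠ 0 → 0 < r i) (hr' : ∀ i, c' i ≠ 0 → 0 < r' i)
    (hs : ∑ i, c i = ∑ i, c' i)
    (h : ∀ t : ℝ, 0 < t → ∑ i, c i / (r i + t) ≤ ∑ i, c' i / (r' i + t)) :
    ∑ i, c' i * Real.log (r' i) ≤ ∑ i, c i * Real.log (r i) := by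
  set g : ℝ → ℝ := fun t => ∑ i, c' i * Real.log (r' i + t) - ∑ i, c i * Real.log (r i + t) with hg
  have hd : ∀ t, 0 ≤ t → HasDerivAt g (∑ i, c' i / (r' i + t) - ∑ i, c i / (r i + t)) t :=
    fun t ht => (log_deriv_aux c' r' hr' t ht).sub (log_deriv_aux c r hr t ht)
  have hm : MonotoneOn g (Set.Ici 0) := by
    apply monotoneOn_of_deriv_nonneg (convex_Ici 0)
    · exact fun t ht => (hd t ht).continuousAt.continuousWithinAt
    · intro t ht
      rw [interior_Ici] at ht
      exact (hd t (le_of_lt ht)).differentiableAt.differentiableWithinAt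
    · intro t ht
      rw [interior_Ici] at ht
      rw [(hd t (le_of_lt ht)).deriv]
      linarith [h t ht]
  have hl : Filter.Tendsto g Filter.atTop (nhds 0) := by
    have := (log_lim_aux c' r').sub (log_lim_aux c r)
    rw [sub_zero] at this
    refine this.congr fun t => ?_
    rw [hg, hs]; ring
  have : g 0 ≤ 0 := by
    refine ge_of_tendsto hl ?_
    filter_upwards [Filter.eventually_ge_atTop 0] with t ht
    exact hm (Set.mem_Ici.2 le_rfl) ht ht
  simp only [hg, add_zero] at this
  linarith

end DPI
section DPI2

noncomputable def Qf {m : Type*} [Fintype m] (ρ σ : Matrix m m ℂ) (t : ℝ) (X : Matrix m m ℂ) : ℝ :=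
  2 * (ρ * X).trace.re - (σ * (X * Xᴴ)).trace.re - t * (ρ * (Xᴴ * X)).trace.re

theorem Qf_eq {m : Type*} [Fintype m] [DecidableEq m] {ρ σ U W : Matrix m m ℂ} {p q : m → ℝ}
    (hU : Uᴴ * U = 1) (hW : Wᴴ * W = 1)
    (hρ : ρ = U * diagonal (fun j => (p j : ℂ)) * Uᴴ)
    (hσ : σ = W * diagonal (fun j => (q j : ℂ)) * Wᴴ) (t : ℝ) (Y : Matrix m m ℂ) :
    Qf ρ σ t (W * Y * Uᴴ) = ∑ i, ∑ j, (2 * (p i * (Uᴴ * W) i j * Y j i : ℂ).re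
      - (q j + t * p i) * Complex.normSq (Y j i)) := by
  have e1 : (ρ * (W * Y * Uᴴ)).trace
      = (diagonal (fun j => (p j : ℂ)) * ((Uᴴ * W) * Y)).trace := by
    rw [hρ, show U * diagonal (fun j => (p j : ℂ)) * Uᴴ * (W * Y * Uᴴ)
      = U * (diagonal (fun j => (p j : ℂ)) * ((Uᴴ * W) * Y) * Uᴴ) by simp only [mul_assoc],
      trace_mul_comm, mul_assoc, hU, mul_one]
  have e2 : (σ * ((W * Y * Uᴴ) * (W * Y * Uᴴ)ᴴ)).trace
      = (diagonal (fun j => (q j : ℂ)) * (Y * Yᴴ)).trace := by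
    rw [hσ, conjTranspose_mul, conjTranspose_mul, conjTranspose_conjTranspose,
      show W * diagonal (fun j => (q j : ℂ)) * Wᴴ * (W * Y * Uᴴ * (U * (Yᴴ * Wᴴ)))
      = W * (diagonal (fun j => (q j : ℂ)) * ((Wᴴ * W) * (Y * ((Uᴴ * U) * Yᴴ))) * Wᴴ) by
        simp only [mul_assoc],
      trace_mul_comm, mul_assoc, hW, hU, mul_one, one_mul, one_mul]
  have e3 : (ρ * ((W * Y * Uᴴ)ᴴ * (W * Y * Uᴴ))).trace
      = (diagonal (fun j => (p j : ℂ)) * (Yᴴ * Y)).trace := by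
    rw [hρ, conjTranspose_mul, conjTranspose_mul, conjTranspose_conjTranspose,
      show U * diagonal (fun j => (p j : ℂ)) * Uᴴ * (U * (Yᴴ * Wᴴ) * (W * Y * Uᴴ))
      = U * (diagonal (fun j => (p j : ℂ)) * ((Uᴴ * U) * (Yᴴ * ((Wᴴ * W) * Y))) * Uᴴ) by
        simp only [mul_assoc],
      trace_mul_comm, mul_assoc, hW, hU, mul_one, one_mul, one_mul]
  rw [Qf, e1, e2, e3]
  have f1 : (diagonal (fun j => (p j : ℂ)) * ((Uᴴ * W) * Y)).trace.re
      = ∑ i, ∑ j, (p i * (Uᴴ * W) i j * Y j i : ℂ).re := by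
    rw [trace, Complex.re_sum]
    refine Finset.sum_congr rfl fun i _ => ?_
    rw [diag_apply, diagonal_mul, mul_apply, Finset.mul_sum, Complex.re_sum]
    simp only [mul_assoc]
  have f2 : (diagonal (fun j => (q j : ℂ)) * (Y * Yᴴ)).trace.re
      = ∑ i, ∑ j, q j * Complex.normSq (Y j i) := by
    rw [trace, Complex.re_sum, Finset.sum_comm]
    refine Finset.sum_congr rfl fun i _ => ?_
    rw [diag_apply, diagonal_mul, mul_apply, Finset.mul_sum, Complex.re_sum]
    refine Finset.sum_congr rfl fun j _ => ?_
    rw [conjTranspose_apply, Complex.star_def, Complex.mul_conj, ← Complex.ofReal_mul, Complex.ofReal_re]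
  have f3 : (diagonal (fun j => (p j : ℂ)) * (Yᴴ * Y)).trace.re
      = ∑ i, ∑ j, p i * Complex.normSq (Y j i) := by
    rw [trace, Complex.re_sum]
    refine Finset.sum_congr rfl fun i _ => ?_
    rw [diag_apply, diagonal_mul, mul_apply, Finset.mul_sum, Complex.re_sum]
    refine Finset.sum_congr rfl fun j _ => ?_
    rw [conjTranspose_apply, Complex.star_def, mul_comm (starRingEnd ℂ _), Complex.mul_conj,
      ← Complex.ofReal_mul, Complex.ofReal_re]
  rw [f1, f2, f3]
  simp only [Finset.mul_sum, ← Finset.sum_sub_distrib]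
  refine Finset.sum_congr rfl fun i _ => Finset.sum_congr rfl fun j _ => ?_
  ring

theorem quad_le (p q t : ℝ) (hp : 0 ≤ p) (hq : 0 ≤ q) (ht : 0 < t) (v y : ℂ) :
    2 * (p * v * y : ℂ).re - (q + t * p) * Complex.normSq y
      ≤ (p * Complex.normSq v) / (q / p + t) := by
  rcases hp.eq_or_lt with rfl | hp
  · simp
    exact mul_nonneg hq (Complex.normSq_nonneg _)
  · have h1 : (p * Complex.normSq v) / (q / p + t) = p ^ 2 * Complex.normSq v / (q + t * p) := by
      field_simp
    have hpos : 0 < q + t * p := by positivity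
    rw [h1, le_div_iff₀ hpos]
    simp only [Complex.normSq_apply, Complex.mul_re, Complex.mul_im, Complex.ofReal_re,
      Complex.ofReal_im]
    nlinarith [sq_nonneg (p * v.re - (q + t * p) * y.re), sq_nonneg (p * v.im + (q + t * p) * y.im)]

theorem quad_eq (p q t : ℝ) (hp : 0 ≤ p) (hq : 0 ≤ q) (ht : 0 < t) (v : ℂ) :
    2 * (p * v * ((p / (q + t * p) : ℝ) * star v) : ℂ).re
      - (q + t * p) * Complex.normSq ((p / (q + t * p) : ℝ) * star v)
      = (p * Complex.normSq v) / (q / p + t) := by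
  rcases hp.eq_or_lt with rfl | hp
  · simp
  · have hpos : q + t * p ≠ 0 := by positivity
    have h1 : (p * Complex.normSq v) / (q / p + t) = p ^ 2 * Complex.normSq v / (q + t * p) := by
      field_simp
    rw [h1, Complex.normSq_mul, Complex.normSq_ofReal, Complex.star_def, Complex.normSq_conj,
      show (p * v * ((p / (q + t * p) : ℝ) * (starRingEnd ℂ) v) : ℂ)
        = ((p * (p / (q + t * p)) * Complex.normSq v : ℝ) : ℂ) by
        push_cast
        rw [← Complex.mul_conj]; ring, Complex.ofReal_re]
    field_simp
    ring

/-- Partial trace over the second factor. -/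
def ptr {m c : Type*} [Fintype c] (ρ : Matrix (m × c) (m × c) ℂ) : Matrix m m ℂ :=
  fun x y => ∑ z, ρ (x, z) (y, z)

theorem trace_ptr {m c : Type*} [Fintype m] [Fintype c] [DecidableEq c]
    (ρ : Matrix (m × c) (m × c) ℂ) (X : Matrix m m ℂ) :
    (ρ * kroneckerMap (· * ·) X (1 : Matrix c c ℂ)).trace = (ptr ρ * X).trace := by
  simp only [trace, diag_apply, mul_apply, ptr, Fintype.sum_prod_type, kroneckerMap_apply, one_apply,
    Finset.sum_mul]
  refine Finset.sum_congr rfl fun i _ => ?_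
  rw [Finset.sum_comm]
  refine Finset.sum_congr rfl fun j _ => ?_
  refine Finset.sum_congr rfl fun z _ => ?_
  simp

theorem Qf_ptr {m c : Type*} [Fintype m] [Fintype c] [DecidableEq c]
    (ρ σ : Matrix (m × c) (m × c) ℂ) (t : ℝ) (X : Matrix m m ℂ) :
    Qf ρ σ t (kroneckerMap (· * ·) X (1 : Matrix c c ℂ)) = Qf (ptr ρ) (ptr σ) t X := by
  have hX : (kroneckerMap (· * ·) X (1 : Matrix c c ℂ))ᴴ = kroneckerMap (· * ·) Xᴴ (1 : Matrix c c ℂ) := by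
    rw [conjTranspose_kronecker, conjTranspose_one]
  rw [Qf, Qf, hX, ← mul_kronecker_mul, ← mul_kronecker_mul, one_mul, trace_ptr, trace_ptr, trace_ptr]

theorem diag_conj {m : Type*} [Fintype m] [DecidableEq m] {ρ U W : Matrix m m ℂ} {p : m → ℝ}
    (hρ : ρ = U * diagonal (fun j => (p j : ℂ)) * Uᴴ) (j : m) :
    ∑ i, p i * Complex.normSq ((Uᴴ * W) i j) = ((Wᴴ * ρ * W) j j).re := by
  have : Wᴴ * ρ * W = (Uᴴ * W)ᴴ * (diagonal (fun j => (p j : ℂ)) * (Uᴴ * W)) := by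
    rw [hρ, conjTranspose_mul, conjTranspose_conjTranspose]; simp only [mul_assoc]
  rw [this, mul_apply, Complex.re_sum]
  refine Finset.sum_congr rfl fun i _ => ?_
  rw [diagonal_mul, conjTranspose_apply, mul_left_comm, Complex.star_def,
    mul_comm (starRingEnd ℂ _), Complex.mul_conj, ← Complex.ofReal_mul, Complex.ofReal_re]

theorem row_norm {m : Type*} [Fintype m] [DecidableEq m] {U W : Matrix m m ℂ}
    (hU : Uᴴ * U = 1) (hW' : W * Wᴴ = 1) (i : m) :
    ∑ j, Complex.normSq ((Uᴴ * W) i j) = 1 := by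
  have h : (Uᴴ * W) * (Uᴴ * W)ᴴ = 1 := by
    rw [conjTranspose_mul, conjTranspose_conjTranspose, mul_assoc, ← mul_assoc W, hW', one_mul, hU]
  have := congrArg Complex.re (congrFun (congrFun h i) i)
  rw [mul_apply, one_apply_eq, Complex.re_sum] at this
  rw [← Complex.one_re, ← this]
  refine Finset.sum_congr rfl fun j _ => ?_
  rw [conjTranspose_apply, Complex.star_def, Complex.mul_conj, Complex.ofReal_re]

theorem rel_expand {m : Type*} [Fintype m] [DecidableEq m] {ρ U W : Matrix m m ℂ} {p q : m → ℝ}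
    (hU : Uᴴ * U = 1) (hW' : W * Wᴴ = 1)
    (hρ : ρ = U * diagonal (fun j => (p j : ℂ)) * Uᴴ)
    (hpos : ∀ i j, p i * Complex.normSq ((Uᴴ * W) i j) ≠ 0 → 0 < q j ∧ 0 < p i) :
    ∑ k : m × m, (p k.1 * Complex.normSq ((Uᴴ * W) k.1 k.2)) * Real.log (q k.2 / p k.1)
      = (∑ j, ((Wᴴ * ρ * W) j j).re * Real.log (q j)) + ∑ i, Real.negMulLog (p i) := by
  have : ∀ k : m × m, (p k.1 * Complex.normSq ((Uᴴ * W) k.1 k.2)) * Real.log (q k.2 / p k.1)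
      = (p k.1 * Complex.normSq ((Uᴴ * W) k.1 k.2)) * Real.log (q k.2)
        - (p k.1 * Complex.normSq ((Uᴴ * W) k.1 k.2)) * Real.log (p k.1) := by
    intro k
    by_cases h : p k.1 * Complex.normSq ((Uᴴ * W) k.1 k.2) = 0
    · rw [h]; ring
    · obtain ⟨h1, h2⟩ := hpos _ _ h
      rw [Real.log_div h1.ne' h2.ne']; ring
  simp only [this, Finset.sum_sub_distrib]
  rw [sub_eq_add_neg]
  congr 1
  · rw [Fintype.sum_prod_type, Finset.sum_comm]
    refine Finset.sum_congr rfl fun j _ => ?_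
    rw [← diag_conj hρ, Finset.sum_mul]
  · rw [Fintype.sum_prod_type, ← Finset.sum_neg_distrib]
    refine Finset.sum_congr rfl fun i _ => ?_
    simp only [mul_comm _ (Real.log _)]
    simp only [← mul_assoc]
    rw [← Finset.mul_sum, row_norm hU hW', Real.negMulLog]
    ring

theorem mass_total {m : Type*} [Fintype m] [DecidableEq m] {ρ U W : Matrix m m ℂ} {p : m → ℝ}
    (hU : Uᴴ * U = 1) (hW' : W * Wᴴ = 1)
    (hρ : ρ = U * diagonal (fun j => (p j : ℂ)) * Uᴴ) :
    ∑ k : m × m, (p k.1 * Complex.normSq ((Uᴴ * W) k.1 k.2)) = ρ.trace.re := by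
  rw [Fintype.sum_prod_type]
  simp only [← Finset.mul_sum, row_norm hU hW', mul_one]
  rw [hρ, trace_mul_comm, ← mul_assoc, hU, one_mul, trace, Complex.re_sum]
  simp

theorem pos_of_ker {m : Type*} [Fintype m] [DecidableEq m] {ρ U W : Matrix m m ℂ} {p q : m → ℝ}
    (hp : ∀ i, 0 ≤ p i) (hq : ∀ i, 0 ≤ q i)
    (hρ : ρ = U * diagonal (fun j => (p j : ℂ)) * Uᴴ)
    (hker : ∀ j, q j = 0 → ((Wᴴ * ρ * W) j j).re = 0) (i j : m)
    (h : p i * Complex.normSq ((Uᴴ * W) i j) ≠ 0) : 0 < q j ∧ 0 < p i := by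
  refine ⟨(hq j).lt_of_ne' fun h0 => h ?_, (hp i).lt_of_ne' fun h0 => h (by rw [h0, zero_mul])⟩
  have h1 := hker j h0
  rw [← diag_conj hρ, Finset.sum_eq_zero_iff_of_nonneg
    (fun i _ => mul_nonneg (hp i) (Complex.normSq_nonneg _))] at h1
  exact h1 i (Finset.mem_univ i)

theorem dpi {m c : Type*} [Fintype m] [DecidableEq m] [Fintype c] [DecidableEq c]
    {ρ σ U W : Matrix (m × c) (m × c) ℂ} {p q : m × c → ℝ}
    {U' W' : Matrix m m ℂ} {p' q' : m → ℝ}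
    (hU : Uᴴ * U = 1) (hW : Wᴴ * W = 1) (hUr : U * Uᴴ = 1) (hWr : W * Wᴴ = 1)
    (hU' : U'ᴴ * U' = 1) (hW' : W'ᴴ * W' = 1) (hWr' : W' * W'ᴴ = 1)
    (hp : ∀ i, 0 ≤ p i) (hq : ∀ i, 0 ≤ q i) (hp' : ∀ i, 0 ≤ p' i) (hq' : ∀ i, 0 ≤ q' i)
    (hρ : ρ = U * diagonal (fun j => (p j : ℂ)) * Uᴴ)
    (hσ : σ = W * diagonal (fun j => (q j : ℂ)) * Wᴴ)
    (hρ' : ptr ρ = U' * diagonal (fun j => (p' j : ℂ)) * U'ᴴ)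
    (hσ' : ptr σ = W' * diagonal (fun j => (q' j : ℂ)) * W'ᴴ)
    (hker : ∀ j, q j = 0 → ((Wᴴ * ρ * W) j j).re = 0)
    (hker' : ∀ j, q' j = 0 → ((W'ᴴ * ptr ρ * W') j j).re = 0) :
    (∑ j, ((Wᴴ * ρ * W) j j).re * Real.log (q j)) + ∑ i, Real.negMulLog (p i)
     ≤ (∑ j, ((W'ᴴ * ptr ρ * W') j j).re * Real.log (q' j)) + ∑ i, Real.negMulLog (p' i) := by
  have P := pos_of_ker (W := W) hp hq hρ hker
  have P' := pos_of_ker (W := W') hp' hq' hρ' hker'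
  rw [← rel_expand hU hWr hρ P, ← rel_expand hU' hWr' hρ' P']
  refine log_compare _ _ _ _ ?_ ?_ ?_ ?_
  · rintro ⟨i, j⟩ h
    exact div_pos (P' i j h).1 (P' i j h).2
  · rintro ⟨i, j⟩ h
    exact div_pos (P i j h).1 (P i j h).2
  · rw [mass_total hU hWr hρ, mass_total hU' hWr' hρ']
    have := trace_ptr ρ 1
    rw [one_kronecker_one, mul_one, mul_one] at this
    rw [this]
  · intro t ht
    let Y : Matrix m m ℂ := fun j i =>
      ((p' i / (q' j + t * p' i) : ℝ) : ℂ) * star ((U'ᴴ * W') i j)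
    have h1 := Qf_eq hU' hW' hρ' hσ' t Y
    have h2 := Qf_ptr ρ σ t (W' * Y * U'ᴴ)
    set X := kroneckerMap (· * ·) (W' * Y * U'ᴴ) (1 : Matrix c c ℂ)
    have h3 := Qf_eq hU hW hρ hσ t (Wᴴ * X * U)
    have h4 : W * (Wᴴ * X * U) * Uᴴ = X := by
      rw [show W * (Wᴴ * X * U) * Uᴴ = (W * Wᴴ) * X * (U * Uᴴ) by simp only [mul_assoc], hUr, hWr,
        one_mul, mul_one]
    rw [h4, h2, h1] at h3
    have h5 : ∑ i, ∑ j, (2 * (p' i * (U'ᴴ * W') i j * Y j i : ℂ).re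
        - (q' j + t * p' i) * Complex.normSq (Y j i))
        = ∑ k : m × m, (p' k.1 * Complex.normSq ((U'ᴴ * W') k.1 k.2)) / (q' k.2 / p' k.1 + t) := by
      rw [Fintype.sum_prod_type]
      exact Finset.sum_congr rfl fun i _ => Finset.sum_congr rfl fun j _ =>
        quad_eq _ _ _ (hp' i) (hq' j) ht _
    rw [← h5, h3]
    refine le_trans ?_ (Fintype.sum_prod_type _).ge
    exact Finset.sum_le_sum fun i _ => Finset.sum_le_sum fun j _ =>
        quad_le _ _ _ (hp i) (hq j) ht _ _

end DPI2
section SSA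

set_option linter.unusedSectionVars false

def lft {P a β : Type*} [DecidableEq a] (e : P ≃ a × β) (τ : Matrix β β ℂ) : Matrix P P ℂ :=
  (kroneckerMap (· * ·) (1 : Matrix a a ℂ) τ).submatrix e e

def ptl {P a β : Type*} [Fintype a] (e : P ≃ a × β) (ρ : Matrix P P ℂ) : Matrix β β ℂ :=
  fun y y' => ∑ x, ρ (e.symm (x, y)) (e.symm (x, y'))

variable {P a β : Type*} [Fintype P] [DecidableEq P] [Fintype a] [DecidableEq a] [Fintype β]
  [DecidableEq β]

theorem lft_mul (e : P ≃ a × β) (τ υ : Matrix β β ℂ) : lft e (τ * υ) = lft e τ * lft e υ := by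
  unfold lft
  rw [submatrix_mul_equiv, ← mul_kronecker_mul, one_mul]

theorem lft_one (e : P ≃ a × β) : lft e (1 : Matrix β β ℂ) = 1 := by
  unfold lft
  rw [one_kronecker_one, submatrix_one_equiv]

theorem lft_star (e : P ≃ a × β) (τ : Matrix β β ℂ) : lft e τᴴ = (lft e τ)ᴴ := by
  unfold lft
  rw [conjTranspose_submatrix, conjTranspose_kronecker, conjTranspose_one]

theorem lft_diag (e : P ≃ a × β) (d : β → ℂ) :
    lft e (diagonal d) = diagonal (fun k => d (e k).2) := by
  ext k l
  simp only [lft, submatrix_apply, kroneckerMap_apply, one_apply, diagonal_apply]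
  by_cases h : k = l
  · subst h; simp
  · have : ¬ ((e k).1 = (e l).1 ∧ (e k).2 = (e l).2) := fun h2 => h (e.injective (Prod.ext h2.1 h2.2))
    rw [if_neg h]
    by_cases h1 : (e k).1 = (e l).1
    · have h3 : ¬ (e k).2 = (e l).2 := fun h3 => this ⟨h1, h3⟩
      simp [h3]
    · simp [h1]

theorem lft_conj (e : P ≃ a × β) (ρ : Matrix P P ℂ) (W : Matrix β β ℂ) (j : β) :
    ∑ x, ((lft e W)ᴴ * ρ * lft e W) (e.symm (x, j)) (e.symm (x, j)) = (Wᴴ * ptl e ρ * W) j j := by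
  have h : ∀ x, ((lft e W)ᴴ * ρ * lft e W) (e.symm (x, j)) (e.symm (x, j))
      = ∑ y', ∑ y, star (W y j) * ρ (e.symm (x, y)) (e.symm (x, y')) * W y' j := by
    intro x
    rw [mul_apply, ← e.symm.sum_comp, Fintype.sum_prod_type, Finset.sum_eq_single x]
    · refine Finset.sum_congr rfl fun y' _ => ?_
      rw [mul_apply, ← e.symm.sum_comp, Fintype.sum_prod_type, Finset.sum_eq_single x]
      · simp [lft, Finset.sum_mul]
      · intro x' _ hx
        simp [lft, hx]
      · simp
    · intro x' _ hx
      simp [lft, hx]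
    · simp
  simp only [h]
  rw [mul_apply, Finset.sum_comm]
  refine Finset.sum_congr rfl fun y' _ => ?_
  rw [mul_apply, Finset.sum_mul, Finset.sum_comm]
  refine Finset.sum_congr rfl fun y _ => ?_
  rw [conjTranspose_apply, ptl, Finset.mul_sum, Finset.sum_mul]

theorem ptl_posSemidef (e : P ≃ a × β) (ρ : Matrix P P ℂ) (h : ρ.PosSemidef) :
    (ptl e ρ).PosSemidef := by
  have : ptl e ρ = ∑ x : a, ρ.submatrix (fun y => e.symm (x, y)) (fun y => e.symm (x, y)) := by
    ext y y'
    simp [ptl, Matrix.sum_apply]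
  rw [this]
  exact posSemidef_sum _ fun x _ => h.submatrix _

theorem ptr_posSemidef {m c : Type*} [Fintype m] [Fintype c] (ρ : Matrix (m × c) (m × c) ℂ)
    (h : ρ.PosSemidef) : (ptr ρ).PosSemidef := by
  have : ptr ρ = ∑ z : c, ρ.submatrix (fun y => (y, z)) (fun y => (y, z)) := by
    ext y y'
    simp [ptr, Matrix.sum_apply]
  rw [this]
  exact posSemidef_sum _ fun x _ => h.submatrix _

theorem lft_terms (e : P ≃ a × β) (ρ : Matrix P P ℂ) (h : ρ.PosSemidef) {W : Matrix β β ℂ}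
    {q : β → ℝ} (hW : Wᴴ * W = 1) (hτ : ptl e ρ = W * diagonal (fun j => (q j : ℂ)) * Wᴴ) :
    (∀ k, q (e k).2 = 0 → (((lft e W)ᴴ * ρ * lft e W) k k).re = 0) ∧
    ∑ k, (((lft e W)ᴴ * ρ * lft e W) k k).re * Real.log (q (e k).2)
      = - ∑ j, Real.negMulLog (q j) := by
  have hd : ∀ j, ∑ x, (((lft e W)ᴴ * ρ * lft e W) (e.symm (x, j)) (e.symm (x, j))).re = q j := by
    intro j
    rw [← Complex.re_sum, lft_conj, hτ, show Wᴴ * (W * diagonal (fun j => (q j : ℂ)) * Wᴴ) * W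
      = (Wᴴ * W) * diagonal (fun j => (q j : ℂ)) * (Wᴴ * W) by simp only [mul_assoc], hW]
    simp
  have hps := h.conjTranspose_mul_mul_same (lft e W)
  constructor
  · intro k hk
    have h1 := hd (e k).2
    rw [hk, Finset.sum_eq_zero_iff_of_nonneg
      (fun x _ => (Complex.le_def.1 (hps.diag_nonneg (i := e.symm (x, (e k).2)))).1)] at h1
    simpa using h1 (e k).1 (Finset.mem_univ _)
  · rw [← e.symm.sum_comp, Fintype.sum_prod_type, Finset.sum_comm, ← Finset.sum_neg_distrib]
    refine Finset.sum_congr rfl fun j _ => ?_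
    simp only [Equiv.apply_symm_apply]
    rw [← Finset.sum_mul, hd, Real.negMulLog]
    ring

theorem ssa_abs {a b c : Type*} [Fintype a] [DecidableEq a] [Fintype b] [DecidableEq b]
    [Fintype c] [DecidableEq c] (ρ : Matrix ((a × b) × c) ((a × b) × c) ℂ) (h : ρ.PosSemidef) :
    vnEntropy ρ + vnEntropy (ptl (Equiv.refl (a × b)) (ptr ρ))
      ≤ vnEntropy (ptr ρ) + vnEntropy (ptl (Equiv.prodAssoc a b c) ρ) := by
  set e := Equiv.prodAssoc a b c
  set e' := Equiv.refl (a × b)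
  have h1 := ptr_posSemidef ρ h
  have h2 := ptl_posSemidef e ρ h
  have h3 := ptl_posSemidef e' _ h1
  obtain ⟨U, u1, u2, u3⟩ := exists_diag ρ h.1
  obtain ⟨U', u1', u2', u3'⟩ := exists_diag _ h1.1
  obtain ⟨W, w1, w2, w3⟩ := exists_diag _ h2.1
  obtain ⟨W', w1', w2', w3'⟩ := exists_diag _ h3.1
  have t := lft_terms e ρ h w1 w3
  have t' := lft_terms e' (ptr ρ) h1 w1' w3'
  have hσ : ptr (lft e (ptl e ρ)) = lft e' (ptl e' (ptr ρ)) := by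
    ext ⟨x, y⟩ ⟨x', y'⟩
    simp only [ptr, lft, ptl, e, e', submatrix_apply, kroneckerMap_apply, Equiv.prodAssoc_apply,
      Equiv.refl_apply, Equiv.prodAssoc_symm_apply, Equiv.refl_symm]
    change ∑ z, (1 : Matrix a a ℂ) x x' * ∑ k, ρ ((k, y), z) ((k, y'), z)
      = (1 : Matrix a a ℂ) x x' * ∑ k, ∑ z, ρ ((k, y), z) ((k, y'), z)
    rw [← Finset.mul_sum, Finset.sum_comm]
  have := dpi (ρ := ρ) (σ := lft e (ptl e ρ)) (W := lft e W) (W' := lft e' W')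
    (q := fun k => h2.1.eigenvalues (e k).2) (q' := fun k => h3.1.eigenvalues (e' k).2)
    u1 (by rw [← lft_star, ← lft_mul, w1, lft_one]) u2
    (by rw [← lft_star, ← lft_mul, w2, lft_one]) u1'
    (by rw [← lft_star, ← lft_mul, w1', lft_one])
    (by rw [← lft_star, ← lft_mul, w2', lft_one])
    h.eigenvalues_nonneg (fun k => h2.eigenvalues_nonneg _) h1.eigenvalues_nonneg
    (fun k => h3.eigenvalues_nonneg _) u3
    (by conv_lhs => rw [w3, lft_mul, lft_mul, lft_diag, lft_star])
    u3'
    (by rw [hσ]; conv_lhs => rw [w3', lft_mul, lft_mul, lft_diag, lft_star])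
    t.1 t'.1
  rw [t.2, t'.2, ← vn_eq_sum, ← vn_eq_sum, ← vn_eq_sum, ← vn_eq_sum] at this
  linarith

end SSA
section Marg

variable {ι : Type*} [Fintype ι] [DecidableEq ι] {dim : ι → ℕ}

abbrev Idx (dim : ι → ℕ) (S : Finset ι) := (i : {j : ι // j ∈ S}) → Fin (dim i.1)

def glue (A C U : Finset ι) (hd : Disjoint A C) (hU : A ∪ C = U) :
    (Idx dim A × Idx dim C) ≃ Idx dim U where
  toFun p := fun i => if h : i.1 ∈ A then p.1 ⟨i.1, h⟩ else
    p.2 ⟨i.1, by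
      have h2 : i.1 ∈ A ∪ C := by rw [hU]; exact i.2
      exact (Finset.mem_union.1 h2).resolve_left h⟩
  invFun x := (fun i => x ⟨i.1, hU ▸ Finset.mem_union_left _ i.2⟩,
    fun i => x ⟨i.1, hU ▸ Finset.mem_union_right _ i.2⟩)
  left_inv p := by
    refine Prod.ext ?_ ?_
    · funext i
      simp [i.2]
    · funext i
      have : i.1 ∉ A := Finset.disjoint_right.1 hd i.2
      simp [this]
  right_inv x := by
    funext i
    simp

theorem glue_swap (A C U : Finset ι) (hd : Disjoint A C) (hU : A ∪ C = U)
    (hU' : C ∪ A = U) (x : Idx dim A) (y : Idx dim C) :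
    glue A C U hd hU (x, y) = glue C A U hd.symm hU' (y, x) := by
  funext i
  simp only [glue, Equiv.coe_fn_mk]
  by_cases h : i.1 ∈ A
  · have : i.1 ∉ C := Finset.disjoint_left.1 hd h
    simp [h, this]
  · have : i.1 ∈ C := by
      have h2 : i.1 ∈ A ∪ C := by rw [hU]; exact i.2
      exact (Finset.mem_union.1 h2).resolve_left h
    simp [h, this]

theorem marginal_left (ψ : Matrix ((i : ι) → Fin (dim i)) ((i : ι) → Fin (dim i)) ℂ)
    (A C U : Finset ι) (hd : Disjoint A C) (hU : A ∪ C = U) (x x' : Idx dim A) :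
    marginal ψ A x x' = ∑ y, marginal ψ U (glue A C U hd hU (x, y)) (glue A C U hd hU (x', y)) := by
  have hAU : ∀ i, i ∉ U → i ∉ A := fun i h h' => h (hU ▸ Finset.mem_union_left _ h')
  have hCU : ∀ i, i ∉ U → i ∉ C := fun i h h' => h (hU ▸ Finset.mem_union_right _ h')
  have hCA : ∀ i, i ∈ C → i ∉ A := fun i h => Finset.disjoint_right.1 hd h
  have hUC : ∀ i, i ∉ A → i ∉ C → i ∉ U := fun i h h' h2 => by
    rw [← hU, Finset.mem_union] at h2
    exact h2.elim h h'
  unfold marginal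
  rw [← Fintype.sum_prod_type']
  let E : ((i : {j : ι // j ∉ A}) → Fin (dim i.1)) ≃
      (Idx dim C × ((i : {j : ι // j ∉ U}) → Fin (dim i.1))) :=
    { toFun := fun z => (fun i => z ⟨i.1, hCA i.1 i.2⟩, fun i => z ⟨i.1, hAU i.1 i.2⟩)
      invFun := fun p => fun i => if h : i.1 ∈ C then p.1 ⟨i.1, h⟩ else p.2 ⟨i.1, hUC i.1 i.2 h⟩
      left_inv := fun z => by
        funext i
        by_cases h : i.1 ∈ C
        · simp [h]
        · simp [h]
      right_inv := fun p => by
        refine Prod.ext ?_ ?_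
        · funext i
          simp [i.2]
        · funext i
          simp [hCU i.1 i.2] }
  refine Fintype.sum_equiv E _ _ fun z => ?_
  have : ∀ w : Idx dim A, ((fun i : ι => if h : i ∈ A then w ⟨i, h⟩ else z ⟨i, h⟩) : (i : ι) → Fin (dim i)) =
      (fun i : ι => if h : i ∈ U then glue A C U hd hU (w, (E z).1) ⟨i, h⟩ else (E z).2 ⟨i, h⟩) := by
    intro w
    funext i
    by_cases h : i ∈ A
    · have h2 : i ∈ U := hU ▸ Finset.mem_union_left _ h
      simp [h, h2, glue]
    · by_cases h2 : i ∈ U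
      · simp [h, h2, glue, E]
      · simp [h, h2, E]
  rw [this x, this x']

theorem marginal_right (ψ : Matrix ((i : ι) → Fin (dim i)) ((i : ι) → Fin (dim i)) ℂ)
    (A C U : Finset ι) (hd : Disjoint A C) (hU : A ∪ C = U) (y y' : Idx dim C) :
    marginal ψ C y y' = ∑ x, marginal ψ U (glue A C U hd hU (x, y)) (glue A C U hd hU (x, y')) := by
  have hU' : C ∪ A = U := by rw [Finset.union_comm, hU]
  rw [marginal_left ψ C A U hd.symm hU']
  simp only [glue_swap A C U hd hU hU']

theorem marginal_posSemidef (ψ : Matrix ((i : ι) → Fin (dim i)) ((i : ι) → Fin (dim i)) ℂ)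
    (h : ψ.PosSemidef) (S : Finset ι) : (marginal ψ S).PosSemidef := by
  have : marginal ψ S = ∑ z : (i : {j : ι // j ∉ S}) → Fin (dim i.1),
      ψ.submatrix (fun (x : Idx dim S) i => if h : i ∈ S then x ⟨i, h⟩ else z ⟨i, h⟩)
        (fun x i => if h : i ∈ S then x ⟨i, h⟩ else z ⟨i, h⟩) := by
    ext x y
    simp [marginal, Matrix.sum_apply]
  rw [this]
  exact posSemidef_sum _ fun x _ => h.submatrix _

theorem marginal_trace (ψ : Matrix ((i : ι) → Fin (dim i)) ((i : ι) → Fin (dim i)) ℂ)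
    (S : Finset ι) : (marginal ψ S).trace = ψ.trace := by
  simp only [trace, diag_apply, marginal]
  rw [← Fintype.sum_prod_type']
  refine Fintype.sum_equiv (Equiv.piEquivPiSubtypeProd (fun i => i ∈ S) (fun i => Fin (dim i))).symm
    _ _ fun z => ?_
  rfl

theorem marginal_univ (ψ : Matrix ((i : ι) → Fin (dim i)) ((i : ι) → Fin (dim i)) ℂ)
    (x y : Idx dim Finset.univ) : marginal ψ Finset.univ x y =
      ψ (fun i => x ⟨i, Finset.mem_univ i⟩) (fun i => y ⟨i, Finset.mem_univ i⟩) := by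
  unfold marginal
  have : IsEmpty {j : ι // j ∉ (Finset.univ : Finset ι)} := ⟨fun j => j.2 (Finset.mem_univ _)⟩
  rw [Fintype.sum_unique]
  simp

theorem mEnt_ssa (ψ : Matrix ((i : ι) → Fin (dim i)) ((i : ι) → Fin (dim i)) ℂ)
    (h : ψ.PosSemidef) (A B C AB BC U : Finset ι) (hAB : Disjoint A B) (hBC : Disjoint B C)
    (hAC : Disjoint A C) (e1 : A ∪ B = AB) (e2 : B ∪ C = BC) (e3 : AB ∪ C = U) :
    mEnt ψ U + mEnt ψ B ≤ mEnt ψ AB + mEnt ψ BC := by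
  have d1 : Disjoint AB C := by rw [← e1]; exact Finset.disjoint_union_left.2 ⟨hAC, hBC⟩
  have d3 : Disjoint A BC := by rw [← e2]; exact Finset.disjoint_union_right.2 ⟨hAB, hAC⟩
  have e4 : A ∪ BC = U := by rw [← e3, ← e1, ← e2, Finset.union_assoc]
  let g1 := glue (dim := dim) AB C U d1 e3
  let g2 := glue (dim := dim) A B AB hAB e1
  let g3 := glue (dim := dim) A BC U d3 e4
  let g4 := glue (dim := dim) B C BC hBC e2
  let E : (Idx dim A × Idx dim B) × Idx dim C ≃ Idx dim U :=
    (g2.prodCongr (Equiv.refl _)).trans g1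
  have hE : ∀ x y z, E ((x, y), z) = g3 (x, g4 (y, z)) := by
    intro x y z
    funext i
    simp only [E, g1, g2, g3, g4, glue, Equiv.trans_apply, Equiv.prodCongr_apply, Equiv.coe_fn_mk,
      Prod.map_apply, Equiv.refl_apply]
    by_cases hA : i.1 ∈ A
    · have : i.1 ∈ AB := e1 ▸ Finset.mem_union_left _ hA
      simp [hA, this]
    · by_cases hB : i.1 ∈ B
      · have : i.1 ∈ AB := e1 ▸ Finset.mem_union_right _ hB
        simp [hA, hB, this]
      · have : i.1 ∉ AB := by
          rw [← e1, Finset.mem_union]; tauto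
        simp [hA, hB, this]
  have hp := marginal_posSemidef ψ h U
  have r1 : ptr ((marginal ψ U).submatrix E E) = (marginal ψ AB).submatrix g2 g2 := by
    ext x y
    simp only [ptr, submatrix_apply]
    rw [marginal_left ψ AB C U d1 e3]
    rfl
  have r2 : ptl (Equiv.prodAssoc _ _ _) ((marginal ψ U).submatrix E E)
      = (marginal ψ BC).submatrix g4 g4 := by
    ext ⟨y, z⟩ ⟨y', z'⟩
    simp only [ptl, submatrix_apply, Equiv.prodAssoc_symm_apply, hE]
    rw [marginal_right ψ A BC U d3 e4]
  have r3 : ptl (Equiv.refl _) ((marginal ψ AB).submatrix g2 g2) = marginal ψ B := by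
    ext y y'
    simp only [ptl, submatrix_apply, Equiv.refl_symm, Equiv.refl_apply]
    rw [marginal_right ψ A B AB hAB e1]
  have := ssa_abs _ (hp.submatrix E)
  rw [r1, r2, r3, vn_reindex _ hp.1, vn_reindex _ (marginal_posSemidef ψ h AB).1,
    vn_reindex _ (marginal_posSemidef ψ h BC).1] at this
  exact this

theorem mEnt_submod (ψ : Matrix ((i : ι) → Fin (dim i)) ((i : ι) → Fin (dim i)) ℂ)
    (h : ψ.PosSemidef) (S T : Finset ι) :
    mEnt ψ (S ∪ T) + mEnt ψ (S ∩ T) ≤ mEnt ψ S + mEnt ψ T := by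
  refine mEnt_ssa ψ h (S \ T) (S ∩ T) (T \ S) S T (S ∪ T) ?_ ?_ ?_ ?_ ?_ ?_
  · exact Finset.disjoint_sdiff_inter S T
  · rw [Finset.inter_comm]; exact (Finset.disjoint_sdiff_inter T S).symm
  · exact disjoint_sdiff_sdiff
  · exact Finset.sdiff_union_inter S T
  · rw [Finset.union_comm, Finset.inter_comm]; exact Finset.sdiff_union_inter T S
  · exact Finset.union_sdiff_self_eq_union

theorem mEnt_nonneg (ψ : Matrix ((i : ι) → Fin (dim i)) ((i : ι) → Fin (dim i)) ℂ)
    (h : ψ.PosSemidef) (ht : ψ.trace = 1) (S : Finset ι) : 0 ≤ mEnt ψ S :=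
  vn_nonneg _ (marginal_posSemidef ψ h S) (by rw [marginal_trace, ht])

theorem mEnt_subadd (ψ : Matrix ((i : ι) → Fin (dim i)) ((i : ι) → Fin (dim i)) ℂ)
    (h : ψ.PosSemidef) (ht : ψ.trace = 1) (S T : Finset ι) :
    mEnt ψ (S ∪ T) ≤ mEnt ψ S + mEnt ψ T := by
  have := mEnt_submod ψ h S T
  have := mEnt_nonneg ψ h ht (S ∩ T)
  linarith

theorem mEnt_le_log (ψ : Matrix ((i : ι) → Fin (dim i)) ((i : ι) → Fin (dim i)) ℂ)
    (h : ψ.PosSemidef) (ht : ψ.trace = 1) (S : Finset ι) (q : ℕ) (hS : ∀ i ∈ S, dim i = q) :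
    mEnt ψ S ≤ S.card * Real.log q := by
  refine (vn_le_log _ (marginal_posSemidef ψ h S) (by rw [marginal_trace, ht])).trans ?_
  rw [Fintype.card_pi]
  simp only [Fintype.card_fin]
  rw [Finset.prod_congr rfl (fun (i : {j // j ∈ S}) _ => hS i.1 i.2)]
  simp

theorem rank_one_form {P : Type*} [Fintype P] [DecidableEq P] (ψ : Matrix P P ℂ)
    (h : ψ.PosSemidef) (hr : ψ.rank = 1) : ∃ v : P → ℂ, ∀ x y, ψ x y = v x * star (v y) := by
  obtain ⟨U, -, -, hU⟩ := exists_diag ψ h.1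
  rw [h.1.rank_eq_card_non_zero_eigs, Fintype.card_eq_one_iff] at hr
  obtain ⟨⟨i, hi⟩, hi2⟩ := hr
  refine ⟨fun x => (Real.sqrt (h.1.eigenvalues i) : ℂ) * U x i, fun x y => ?_⟩
  conv_lhs => rw [hU]
  rw [mul_apply, Finset.sum_eq_single i]
  · rw [mul_diagonal, conjTranspose_apply, star_mul]
    have : (h.1.eigenvalues i : ℂ)
        = (Real.sqrt (h.1.eigenvalues i) : ℂ) * (Real.sqrt (h.1.eigenvalues i) : ℂ) := by
      rw [← Complex.ofReal_mul, Real.mul_self_sqrt (h.eigenvalues_nonneg i)]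
    have h2 : star ((Real.sqrt (h.1.eigenvalues i) : ℝ) : ℂ) = (Real.sqrt (h.1.eigenvalues i) : ℂ) :=
      Complex.conj_ofReal _
    rw [this, h2]
    ring
  · intro j _ hj
    have : h.1.eigenvalues j = 0 := by
      by_contra h0
      exact hj (congrArg Subtype.val (hi2 ⟨j, h0⟩))
    rw [mul_diagonal, this]
    simp
  · simp

theorem mEnt_compl (ψ : Matrix ((i : ι) → Fin (dim i)) ((i : ι) → Fin (dim i)) ℂ)
    (h : ψ.PosSemidef) (hr : ψ.rank = 1) (S T : Finset ι) (hd : Disjoint S T)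
    (hu : S ∪ T = Finset.univ) : mEnt ψ S = mEnt ψ T := by
  obtain ⟨v, hv⟩ := rank_one_form ψ h hr
  let M : Matrix (Idx dim S) (Idx dim T) ℂ := fun a c =>
    v (fun i => glue S T Finset.univ hd hu (a, c) ⟨i, Finset.mem_univ i⟩)
  have h1 : marginal ψ S = M * Mᴴ := by
    ext a a'
    rw [marginal_left ψ S T Finset.univ hd hu, mul_apply]
    refine Finset.sum_congr rfl fun c _ => ?_
    rw [marginal_univ, hv, conjTranspose_apply]
  have h2 : marginal ψ T = (Mᴴ * M)ᵀ := by
    ext a a'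
    rw [marginal_right ψ S T Finset.univ hd hu, transpose_apply, mul_apply]
    refine Finset.sum_congr rfl fun c _ => ?_
    rw [marginal_univ, hv, conjTranspose_apply, mul_comm]
  rw [mEnt, mEnt, h1, h2, vn_transpose _ (isHermitian_conjTranspose_mul_self M), vn_mul_comm]

end Marg

section Han

theorem perm_avg {n : ℕ} (f : Finset (Fin n) → ℝ) (A : Finset (Fin n)) :
    (∑ π : Equiv.Perm (Fin n), f (A.map π.toEmbedding)) * (n.choose A.card : ℝ)
      = (n.factorial : ℝ) * ∑ S ∈ Finset.powersetCard A.card Finset.univ, f S := by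
  have inv : ∀ B : Finset (Fin n), B.card = A.card →
      ∑ π : Equiv.Perm (Fin n), f (B.map π.toEmbedding)
        = ∑ π : Equiv.Perm (Fin n), f (A.map π.toEmbedding) := by
    intro B hB
    obtain ⟨τ, hτ⟩ : ∃ τ : Equiv.Perm (Fin n), A.map τ.toEmbedding = B := by
      let e : {x // x ∈ A} ≃ {x // x ∈ B} := Fintype.equivOfCardEq (by simp [hB])
      refine ⟨e.extendSubtype, ?_⟩
      refine Finset.eq_of_subset_of_card_le ?_ (by simp [hB])
      intro y hy
      rw [Finset.mem_map] at hy
      obtain ⟨x, hx, rfl⟩ := hy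
      exact e.extendSubtype_mem x hx
    rw [← hτ]
    refine Fintype.sum_equiv (Equiv.mulRight τ) _ _ fun π => ?_
    rw [Finset.map_map]
    rfl
  have h1 : ∑ S ∈ Finset.powersetCard A.card (Finset.univ : Finset (Fin n)),
      ∑ π : Equiv.Perm (Fin n), f (S.map π.toEmbedding)
      = (n.choose A.card : ℝ) * ∑ π : Equiv.Perm (Fin n), f (A.map π.toEmbedding) := by
    rw [Finset.sum_congr rfl fun S hS => inv S (Finset.mem_powersetCard.1 hS).2]
    simp
  rw [mul_comm, ← h1, Finset.sum_comm]
  have h2 : ∀ π : Equiv.Perm (Fin n),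
      ∑ S ∈ Finset.powersetCard A.card (Finset.univ : Finset (Fin n)), f (S.map π.toEmbedding)
      = ∑ S ∈ Finset.powersetCard A.card (Finset.univ : Finset (Fin n)), f S := by
    intro π
    refine Finset.sum_bij' (fun S _ => S.map π.toEmbedding) (fun S _ => S.map π.symm.toEmbedding)
      ?_ ?_ ?_ ?_ ?_
    · intro S hS; simpa [Finset.mem_powersetCard] using hS
    · intro S hS; simpa [Finset.mem_powersetCard] using hS
    · intro S hS; ext x; simp
    · intro S hS; ext x; simp
    · intros; rfl
  simp [h2, Fintype.card_perm]

noncomputable def avgf {n : ℕ} (f : Finset (Fin n) → ℝ) (k : ℕ) : ℝ :=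
  (∑ S ∈ Finset.powersetCard k (Finset.univ : Finset (Fin n)), f S) / (n.choose k : ℝ)

theorem avgf_eq {n : ℕ} (f : Finset (Fin n) → ℝ) (A : Finset (Fin n)) :
    avgf f A.card = (∑ π : Equiv.Perm (Fin n), f (A.map π.toEmbedding)) / (n.factorial : ℝ) := by
  have h1 : (n.factorial : ℝ) ≠ 0 := by exact_mod_cast n.factorial_ne_zero
  have h2 : (n.choose A.card : ℝ) ≠ 0 := by
    have : A.card ≤ n := by simpa using Finset.card_le_univ A
    exact_mod_cast (Nat.choose_pos this).ne'
  rw [avgf, div_eq_div_iff h2 h1, mul_comm, ← perm_avg]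

theorem avgf_concave {n : ℕ} (f : Finset (Fin n) → ℝ)
    (hf : ∀ S T, f (S ∪ T) + f (S ∩ T) ≤ f S + f T) (k : ℕ) (hk : k + 2 ≤ n) :
    avgf f (k + 2) + avgf f k ≤ 2 * avgf f (k + 1) := by
  obtain ⟨U, -, hU⟩ := Finset.exists_subset_card_eq (s := (Finset.univ : Finset (Fin n)))
    (n := k + 2) (by simpa using hk)
  obtain ⟨a, ha⟩ : U.Nonempty := Finset.card_pos.1 (by omega)
  have ca := Finset.card_erase_of_mem ha
  obtain ⟨b, hb⟩ : (U.erase a).Nonempty := Finset.card_pos.1 (by omega)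
  have hab : b ≠ a := (Finset.mem_erase.1 hb).1
  have hbU := (Finset.mem_erase.1 hb).2
  have cb := Finset.card_erase_of_mem hbU
  have cab := Finset.card_erase_of_mem hb
  have eu : U.erase a ∪ U.erase b = U := by
    ext x; simp only [Finset.mem_union, Finset.mem_erase]
    constructor
    · tauto
    · intro hx
      by_cases h : x = a
      · right; exact ⟨h ▸ hab.symm, hx⟩
      · left; exact ⟨h, hx⟩
  have ei : U.erase a ∩ U.erase b = (U.erase a).erase b := by
    ext x; simp only [Finset.mem_inter, Finset.mem_erase]; tauto
  rw [two_mul]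
  nth_rewrite 1 [show k + 2 = U.card from hU.symm]
  rw [show avgf f k = avgf f ((U.erase a).erase b).card by congr 1; omega]
  nth_rewrite 1 [show k + 1 = (U.erase a).card by omega]
  rw [show avgf f (k + 1) = avgf f (U.erase b).card by congr 1; omega]
  rw [avgf_eq, avgf_eq, avgf_eq, avgf_eq, ← add_div, ← add_div, ← Finset.sum_add_distrib,
    ← Finset.sum_add_distrib]
  refine div_le_div_of_nonneg_right (Finset.sum_le_sum fun π _ => ?_) (by positivity)
  have := hf ((U.erase a).map π.toEmbedding) ((U.erase b).map π.toEmbedding)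
  rwa [← Finset.map_union, ← Finset.map_inter, eu, ei] at this

theorem concave_ratio (n : ℕ) (s : ℕ → ℝ) (h0 : 0 ≤ s 0)
    (hs : ∀ k, k + 2 ≤ n → s (k + 2) + s k ≤ 2 * s (k + 1)) (t m : ℕ) (ht : 1 ≤ t) (htm : t ≤ m) (hm : m ≤ n) :
    (t : ℝ) * s m ≤ m * s t := by
  have step : ∀ k, k + 1 ≤ n → (k : ℝ) * s (k + 1) ≤ (k + 1) * s k := by
    intro k
    induction k with
    | zero => intro _; simpa using h0
    | succ k ih =>
      intro hk
      have h1 := ih (by omega)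
      have h2 := hs k (by omega)
      have h3 : (k + 1 : ℝ) * (s (k + 2) + s k) ≤ (k + 1) * (2 * s (k + 1)) :=
        mul_le_mul_of_nonneg_left h2 (by positivity)
      push_cast
      show ((k : ℝ) + 1) * s (k + 2) ≤ _
      linarith
  induction m, htm using Nat.le_induction with
  | base => exact le_rfl
  | succ m hm' ih =>
    have h1 := ih (by omega)
    have h2 := step m hm
    have hm0 : (0 : ℝ) < m := by exact_mod_cast (by omega : 0 < m)
    push_cast
    have h3 := mul_le_mul_of_nonneg_left h2 (Nat.cast_nonneg (α := ℝ) t)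
    have h4 := mul_le_mul_of_nonneg_left h1 (by positivity : (0 : ℝ) ≤ (m : ℝ) + 1)
    refine le_of_mul_le_mul_left ?_ hm0
    linarith

end Han
section Prod

theorem vn_kron {m k : Type*} [Fintype m] [DecidableEq m] [Fintype k] [DecidableEq k]
    (ρ : Matrix m m ℂ) (σ : Matrix k k ℂ) (hρ : ρ.IsHermitian) (hσ : σ.IsHermitian)
    (tρ : ρ.trace = 1) (tσ : σ.trace = 1) :
    vnEntropy (kroneckerMap (· * ·) ρ σ) = vnEntropy ρ + vnEntropy σ := by
  obtain ⟨U, u1, -, u3⟩ := exists_diag ρ hρ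
  obtain ⟨W, w1, -, w3⟩ := exists_diag σ hσ
  have h1 : (kroneckerMap (· * ·) U W)ᴴ * kroneckerMap (· * ·) U W = 1 := by
    rw [conjTranspose_kronecker, ← mul_kronecker_mul, u1, w1, one_kronecker_one]
  have h2 : kroneckerMap (· * ·) ρ σ = kroneckerMap (· * ·) U W *
      diagonal (fun k => ((hρ.eigenvalues k.1 * hσ.eigenvalues k.2 : ℝ) : ℂ))
      * (kroneckerMap (· * ·) U W)ᴴ := by
    conv_lhs => rw [u3, w3]
    rw [mul_kronecker_mul, mul_kronecker_mul, conjTranspose_kronecker, diagonal_kronecker_diagonal]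
    simp only [Complex.ofReal_mul]
  rw [vn_of_diag h1 h2, vn_eq_sum _ hρ, vn_eq_sum _ hσ, Fintype.sum_prod_type]
  simp only [Real.negMulLog_mul, Finset.sum_add_distrib]
  congr 1
  · simp only [← Finset.sum_mul, eig_sum σ hσ tσ, one_mul]
  · simp only [← Finset.mul_sum]
    rw [← Finset.sum_mul, eig_sum ρ hρ tρ, one_mul]

theorem vn_maxmix {m : Type*} [Fintype m] [DecidableEq m] (K : ℕ) (hK : 1 ≤ K)
    (hm : Fintype.card m = K) : vnEntropy ((K : ℂ)⁻¹ • (1 : Matrix m m ℂ)) = Real.log K := by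
  have h2 : (K : ℂ)⁻¹ • (1 : Matrix m m ℂ)
      = 1 * diagonal (fun _ => (((K : ℝ)⁻¹ : ℝ) : ℂ)) * (1 : Matrix m m ℂ)ᴴ := by
    rw [one_mul, conjTranspose_one, mul_one, smul_one_eq_diagonal]
    simp
  have hK0 : (K : ℝ) ≠ 0 := by exact_mod_cast (by omega : K ≠ 0)
  rw [vn_of_diag (by simp) h2]
  simp only [Real.negMulLog, Finset.sum_const, Finset.card_univ, hm, Real.log_inv, nsmul_eq_mul]
  field_simp

end Prod

/-- qubit-ebit Singleton bound, dimension inequality: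
`log K ≤ (n-d+1) σ̿ ≤ (n-d+1) log q`, and if `2(d-1) < n` also
`log K ≤ (n-d+1) σ̄`. Systems: `R = Sum.inr 0`, `A_f = Sum.inr 1`, `B_in = Sum.inr 2`. -/
theorem ea_dimension_bound
    (n d q K : ℕ) (hd : 2 ≤ d) (hdn : d ≤ n) (hq : 2 ≤ q) (hK : 1 ≤ K)
    (dim : Fin n ⊕ Fin 3 → ℕ)
    (hdimX : ∀ i : Fin n, dim (Sum.inl i) = q)
    (hdimR : dim (Sum.inr 0) = K)
    (ψ : Matrix ((i : Fin n ⊕ Fin 3) → Fin (dim i))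
                ((i : Fin n ⊕ Fin 3) → Fin (dim i)) ℂ)
    (hpsd : ψ.PosSemidef) (htr : ψ.trace = 1) (hpure : ψ.rank = 1)
    (hmaxmix : marginal ψ ({Sum.inr 0} : Finset (Fin n ⊕ Fin 3)) = (K : ℂ)⁻¹ • 1)
    (hprod : ∀ x y, marginal ψ ({Sum.inr 0, Sum.inr 2} : Finset (Fin n ⊕ Fin 3)) x y =
      marginal ψ ({Sum.inr 0} : Finset (Fin n ⊕ Fin 3))
          (restInd (by simp) x) (restInd (by simp) y) *
        marginal ψ ({Sum.inr 2} : Finset (Fin n ⊕ Fin 3))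
          (restInd (by simp) x) (restInd (by simp) y))
    (hdec : ∀ I J : Finset (Fin n), Disjoint I J → I ∪ J = Finset.univ →
      I.card = n - d + 1 → J.card = d - 1 →
      mEnt ψ (I.image Sum.inl ∪ ({Sum.inr 2} : Finset (Fin n ⊕ Fin 3))) =
        mEnt ψ ({Sum.inr 0} : Finset (Fin n ⊕ Fin 3)) + mEnt ψ ({Sum.inr 1} : Finset (Fin n ⊕ Fin 3)) + mEnt ψ (J.image Sum.inl)) :
    Real.log K ≤ ((n : ℝ) - d + 1) *
        ((1 / ((n : ℝ) - d + 1)) * ((∑ I ∈ Finset.powersetCard (n - d + 1) (Finset.univ : Finset (Fin n)),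
            mEnt ψ (I.image Sum.inl)) / (n.choose (n - d + 1) : ℝ)))
    ∧ ((n : ℝ) - d + 1) * ((1 / ((n : ℝ) - d + 1)) * ((∑ I ∈ Finset.powersetCard (n - d + 1) (Finset.univ : Finset (Fin n)),
            mEnt ψ (I.image Sum.inl)) / (n.choose (n - d + 1) : ℝ)))
      ≤ ((n : ℝ) - d + 1) * Real.log q
    ∧ (2 * (d - 1) < n →
        Real.log K ≤ ((n : ℝ) - d + 1) *
          ((1 / ((d : ℝ) - 1)) * ((∑ J ∈ Finset.powersetCard (d - 1) (Finset.univ : Finset (Fin n)),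
            mEnt ψ (J.image Sum.inl)) / (n.choose (d - 1) : ℝ)))) := by
  have hne : ((n : ℝ) - d + 1) ≠ 0 := by
    have : (d : ℝ) ≤ n := by exact_mod_cast hdn
    linarith
  have hcast : ((n - d + 1 : ℕ) : ℝ) = (n : ℝ) - d + 1 := by
    push_cast [Nat.cast_sub hdn]; ring
  have hcast2 : ((d - 1 : ℕ) : ℝ) = (d : ℝ) - 1 := by
    push_cast [Nat.cast_sub (by omega : 1 ≤ d)]; ring
  set f : Finset (Fin n) → ℝ := fun S => mEnt ψ (S.image Sum.inl) with hf
  have hR : mEnt ψ ({Sum.inr 0} : Finset (Fin n ⊕ Fin 3)) = Real.log K := by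
    rw [mEnt, hmaxmix, vn_maxmix K hK]
    rw [Fintype.card_pi]
    simp [hdimR]
  have hRB : mEnt ψ ({Sum.inr 0, Sum.inr 2} : Finset (Fin n ⊕ Fin 3))
      = Real.log K + mEnt ψ ({Sum.inr 2} : Finset (Fin n ⊕ Fin 3)) := by
    have hd0 : Disjoint ({Sum.inr 0} : Finset (Fin n ⊕ Fin 3)) {Sum.inr 2} := by simp
    have hU0 : ({Sum.inr 0} : Finset (Fin n ⊕ Fin 3)) ∪ {Sum.inr 2} = {Sum.inr 0, Sum.inr 2} := rfl
    have e : (marginal ψ ({Sum.inr 0, Sum.inr 2} : Finset (Fin n ⊕ Fin 3))).submatrix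
        (glue _ _ _ hd0 hU0) (glue _ _ _ hd0 hU0)
        = kroneckerMap (· * ·) (marginal ψ {Sum.inr 0}) (marginal ψ {Sum.inr 2}) := by
      ext x y
      rw [submatrix_apply, hprod, kroneckerMap_apply]
      have k1 : ∀ z : Idx dim {Sum.inr 0} × Idx dim {Sum.inr 2},
          restInd (by simp) (glue _ _ _ hd0 hU0 z) = z.1 := fun z =>
        congrArg Prod.fst ((glue _ _ _ hd0 hU0).symm_apply_apply z)
      have k2 : ∀ z : Idx dim {Sum.inr 0} × Idx dim {Sum.inr 2},
          restInd (by simp) (glue _ _ _ hd0 hU0 z) = z.2 := fun z =>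
        congrArg Prod.snd ((glue _ _ _ hd0 hU0).symm_apply_apply z)
      rw [k1, k1, k2, k2]
    rw [← hR, mEnt, mEnt, mEnt, ← vn_reindex _ (marginal_posSemidef ψ hpsd _).1
      (glue _ _ _ hd0 hU0), e, vn_kron _ _ (marginal_posSemidef ψ hpsd _).1
      (marginal_posSemidef ψ hpsd _).1 (by rw [marginal_trace, htr]) (by rw [marginal_trace, htr])]
  have hmain : ∀ I ∈ Finset.powersetCard (n - d + 1) (Finset.univ : Finset (Fin n)),
      Real.log K ≤ f I := by
    intro I hI
    have hc := (Finset.mem_powersetCard.1 hI).2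
    have h1 := hdec I Iᶜ disjoint_compl_right (Finset.union_compl I) hc (by
      rw [Finset.card_compl, Fintype.card_fin, hc]; omega)
    rw [hR] at h1
    have h2 := mEnt_subadd ψ hpsd htr (I.image Sum.inl) ({Sum.inr 2} : Finset (Fin n ⊕ Fin 3))
    have h3 : mEnt ψ ({Sum.inr 0, Sum.inr 2} : Finset (Fin n ⊕ Fin 3))
        = mEnt ψ ({Sum.inr 1} ∪ (I.image Sum.inl ∪ Iᶜ.image Sum.inl)) := by
      apply mEnt_compl ψ hpsd hpure
      · rw [Finset.disjoint_left]
        intro x hx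
        simp only [Finset.mem_insert, Finset.mem_singleton] at hx
        rcases hx with rfl | rfl <;> simp
      · ext x
        rcases x with x | x
        · by_cases hx : x ∈ I <;> simp [hx]
        · fin_cases x <;> simp
    have h4 := mEnt_subadd ψ hpsd htr ({Sum.inr 1} : Finset (Fin n ⊕ Fin 3))
      (I.image Sum.inl ∪ Iᶜ.image Sum.inl)
    have h5 := mEnt_subadd ψ hpsd htr (I.image (Sum.inl : Fin n → Fin n ⊕ Fin 3)) (Iᶜ.image Sum.inl)
    simp only [hf]
    linarith
  have hq2 : ∀ I ∈ Finset.powersetCard (n - d + 1) (Finset.univ : Finset (Fin n)),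
      f I ≤ ((n : ℝ) - d + 1) * Real.log q := by
    intro I hI
    have hc := (Finset.mem_powersetCard.1 hI).2
    have := mEnt_le_log ψ hpsd htr (I.image Sum.inl) q (by
      intro i hi
      obtain ⟨j, -, rfl⟩ := Finset.mem_image.1 hi
      exact hdimX j)
    rwa [Finset.card_image_of_injective _ Sum.inl_injective, hc, hcast] at this
  have hcpos : (0 : ℝ) < (n.choose (n - d + 1) : ℝ) := by
    exact_mod_cast Nat.choose_pos (by omega)
  have hcardp : ((Finset.powersetCard (n - d + 1) (Finset.univ : Finset (Fin n))).card : ℝ)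
      = (n.choose (n - d + 1) : ℝ) := by simp
  have hA : Real.log K ≤ avgf f (n - d + 1) := by
    rw [avgf, le_div_iff₀ hcpos, mul_comm, ← hcardp, ← nsmul_eq_mul]
    exact Finset.card_nsmul_le_sum _ _ _ hmain
  have hB : avgf f (n - d + 1) ≤ ((n : ℝ) - d + 1) * Real.log q := by
    rw [avgf, div_le_iff₀ hcpos, mul_comm _ (n.choose (n - d + 1) : ℝ), ← hcardp, ← nsmul_eq_mul]
    exact Finset.sum_le_card_nsmul _ _ _ hq2
  have hE : ((n : ℝ) - d + 1) * ((1 / ((n : ℝ) - d + 1)) * avgf f (n - d + 1))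
      = avgf f (n - d + 1) := by
    field_simp
  change Real.log K ≤ ((n : ℝ) - d + 1) * ((1 / ((n : ℝ) - d + 1)) * avgf f (n - d + 1)) ∧
    ((n : ℝ) - d + 1) * ((1 / ((n : ℝ) - d + 1)) * avgf f (n - d + 1)) ≤ _ ∧
    (2 * (d - 1) < n → Real.log K ≤ ((n : ℝ) - d + 1) * ((1 / ((d : ℝ) - 1)) * avgf f (d - 1)))
  rw [hE]
  refine ⟨hA, hB, fun h2 => ?_⟩
  have hsub : ∀ S T, f (S ∪ T) + f (S ∩ T) ≤ f S + f T := by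
    intro S T
    simp only [hf]
    rw [Finset.image_union, Finset.image_inter _ _ Sum.inl_injective]
    exact mEnt_submod ψ hpsd _ _
  have hr := concave_ratio n (avgf f)
    (div_nonneg (Finset.sum_nonneg fun S _ => mEnt_nonneg ψ hpsd htr _) (by positivity))
    (avgf_concave f hsub) (d - 1) (n - d + 1) (by omega) (by omega) (by omega)
  rw [hcast, hcast2] at hr
  have hd1 : (0 : ℝ) < (d : ℝ) - 1 := by
    rw [← hcast2]; exact_mod_cast (by omega : 0 < d - 1)
  refine hA.trans ?_
  rw [show ((n : ℝ) - d + 1) * ((1 / ((d : ℝ) - 1)) * avgf f (d - 1))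
    = (((n : ℝ) - d + 1) * avgf f (d - 1)) / ((d : ℝ) - 1) by ring, le_div_iff₀ hd1]
  linarith
end

section
/- Qubit-ebit Singleton bound, piecewise-linear part. Let q ≥ 2, K ≥ 1, 2 ≤ d ≤ n, and 2(d−1) ≥ n. Let ψ be a pure quantum state on R ⊗ A_f ⊗ X_1 ⊗ … ⊗ X_n ⊗ B_in, where R has dimension K, each X_i has dimension q, the marginal of ψ on R is the maximally mixed state (1/K)·Id_K, and the marginal of ψ on R ⊗ B_in is the tensor product of its marginals on R and on B_in. Suppose that for every partition {1,…,n} = I ∪ J with |I| = n−d+1 and |J| = d−1, S(X_I B_in)_ψ = S(R)_ψ + S(A_f)_ψ + S(X_J)_ψ. Then log K ≤ ((n−d+1)/(3d−3−n)) · ( ℓ + (2d−2−n)·σ̿ ), where ℓ := S(B_in)_ψ − S(A_f)_ψ and σ̿ := (1/(n−d+1))·E_{|I|=n−d+1} S(X_I)_ψ. -/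
open scoped BigOperators ComplexOrder

namespace EA

open Matrix Polynomial
open scoped Kronecker

/-- Unitary diagonalization data. -/
structure Diag {m : Type*} [Fintype m] [DecidableEq m] (ρ : Matrix m m ℂ) (U : Matrix m m ℂ)
    (r : m → ℝ) : Prop where
  left : Uᴴ * U = 1
  right : U * Uᴴ = 1
  eq : ρ = U * diagonal (fun i => (r i : ℂ)) * Uᴴ

theorem ent_roots {m : Type*} [Fintype m] [DecidableEq m] {ρ : Matrix m m ℂ} (h : ρ.IsHermitian) :
    vnEntropy ρ = -(ρ.charpoly.roots.map (fun z : ℂ => z.re * Real.log z.re)).sum := by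
  rw [vnEntropy, dif_pos h, h.roots_charpoly_eq_eigenvalues]
  simp

theorem Diag.herm {m : Type*} [Fintype m] [DecidableEq m] {ρ U : Matrix m m ℂ} {r : m → ℝ}
    (h : Diag ρ U r) : ρ.IsHermitian := by
  rw [h.eq, Matrix.IsHermitian]
  simp only [conjTranspose_mul, conjTranspose_conjTranspose, diagonal_conjTranspose, Matrix.mul_assoc]
  congr 3
  ext i
  simp

theorem Diag.ent {m : Type*} [Fintype m] [DecidableEq m] {ρ U : Matrix m m ℂ} {r : m → ℝ}
    (h : Diag ρ U r) : vnEntropy ρ = -∑ i, r i * Real.log (r i) := by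
  rw [ent_roots h.herm]
  have : ρ.charpoly = ∏ i, (X - C (r i : ℂ)) := by
    rw [h.eq, charpoly_mul_comm, ← Matrix.mul_assoc, h.left, Matrix.one_mul, charpoly_diagonal]
  rw [this, Polynomial.roots_prod _ _ (by simp [Finset.prod_ne_zero_iff, Polynomial.X_sub_C_ne_zero])]
  simp

theorem exists_diag {m : Type*} [Fintype m] [DecidableEq m] {ρ : Matrix m m ℂ} (h : ρ.PosSemidef) :
    ∃ U r, Diag ρ U r ∧ ∀ i, 0 ≤ r i := by
  refine ⟨h.1.eigenvectorUnitary, h.1.eigenvalues, ⟨?_, ?_, ?_⟩, h.eigenvalues_nonneg⟩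
  · exact Unitary.coe_star_mul_self _
  · exact Unitary.coe_mul_star_self _
  · conv_lhs => rw [h.1.spectral_theorem, Unitary.conjStarAlgAut_apply]
    rfl

theorem Diag.kron {m k : Type*} [Fintype m] [DecidableEq m] [Fintype k] [DecidableEq k]
    {ρ U : Matrix m m ℂ} {r : m → ℝ} {σ V : Matrix k k ℂ} {s : k → ℝ}
    (h : Diag ρ U r) (h' : Diag σ V s) :
    Diag (ρ ⊗ₖ σ) (U ⊗ₖ V) (fun i => r i.1 * s i.2) := by
  refine ⟨?_, ?_, ?_⟩
  · rw [conjTranspose_kronecker, ← mul_kronecker_mul, h.left, h'.left, one_kronecker_one]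
  · rw [conjTranspose_kronecker, ← mul_kronecker_mul, h.right, h'.right, one_kronecker_one]
  · rw [conjTranspose_kronecker]
    have : diagonal (fun i : m × k => ((r i.1 * s i.2 : ℝ) : ℂ)) =
        diagonal (fun i => (r i : ℂ)) ⊗ₖ diagonal (fun i => (s i : ℂ)) := by
      rw [diagonal_kronecker_diagonal]; simp
    rw [this, ← mul_kronecker_mul, ← mul_kronecker_mul, ← h.eq, ← h'.eq]

theorem ent_submatrix {m k : Type*} [Fintype m] [DecidableEq m] [Fintype k] [DecidableEq k]
    (e : k ≃ m) {ρ : Matrix m m ℂ} (h : ρ.IsHermitian) :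
    vnEntropy (ρ.submatrix e e) = vnEntropy ρ := by
  rw [ent_roots h, ent_roots (h.submatrix e)]
  have := charpoly_reindex e.symm ρ
  rw [reindex_apply] at this
  simp only [Equiv.symm_symm] at this
  rw [this]

theorem ent_mul_comm {m k : Type*} [Fintype m] [DecidableEq m] [Fintype k] [DecidableEq k]
    (A : Matrix m k ℂ) (B : Matrix k m ℂ) (h1 : (A * B).IsHermitian) (h2 : (B * A).IsHermitian) :
    vnEntropy (A * B) = vnEntropy (B * A) := by
  rw [ent_roots h1, ent_roots h2]
  have h := congrArg Polynomial.roots (charpoly_mul_comm' A B)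
  rw [roots_mul (mul_ne_zero (by simp) (charpoly_monic _).ne_zero),
    roots_mul (mul_ne_zero (by simp) (charpoly_monic _).ne_zero), roots_X_pow, roots_X_pow] at h
  have h := congrArg (fun s => (s.map (fun z : ℂ => z.re * Real.log z.re)).sum) h
  simpa [Multiset.map_nsmul, Multiset.sum_nsmul] using h

theorem ent_transpose {m : Type*} [Fintype m] [DecidableEq m] 
    {ρ : Matrix m m ℂ} (h : ρ.IsHermitian) :
    vnEntropy ρᵀ = vnEntropy ρ := by
  rw [ent_roots h, ent_roots h.transpose, charpoly_transpose]

/-- rank one matrices -/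
theorem rank_one {m : Type*} [Fintype m] [DecidableEq m] {ρ : Matrix m m ℂ} (h : ρ.rank = 1) :
    ∃ u w : m → ℂ, ∀ x y, ρ x y = u x * w y := by
  rw [Matrix.rank, finrank_eq_one_iff'] at h
  obtain ⟨v, -, hv⟩ := h
  have : ∀ y, ∃ c : ℂ, ∀ x, ρ x y = v.1 x * c := by
    intro y
    obtain ⟨c, hc⟩ := hv ⟨ρ.mulVecLin (Pi.single y 1), ⟨_, rfl⟩⟩
    refine ⟨c, fun x => ?_⟩
    have := congrFun (congrArg Subtype.val hc) x
    simp at this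
    rw [← this, mul_comm]
  choose w hw using this
  exact ⟨v.1, w, fun x y => hw y x⟩

end EA
namespace EA

open Matrix Filter Topology
open scoped Kronecker

theorem log_mono {κ κ' : Type*} [Fintype κ] [Fintype κ'] (c s r : κ → ℝ) (c' s' r' : κ' → ℝ)
    (h : ∀ k, c k ≠ 0 → 0 < s k ∧ 0 < r k) (h' : ∀ k, c' k ≠ 0 → 0 < s' k ∧ 0 < r' k)
    (hsum : ∑ k, c k = ∑ k, c' k)
    (hG : ∀ t : ℝ, 0 < t → ∑ k, c' k * (r' k / (s' k + t * r' k)) ≤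
      ∑ k, c k * (r k / (s k + t * r k))) :
    ∑ k, c k * Real.log (s k) - ∑ k, c' k * Real.log (s' k) ≤
    ∑ k, c k * Real.log (r k) - ∑ k, c' k * Real.log (r' k) := by
  have key : ∀ c s r : ℝ, (c ≠ 0 → 0 < s ∧ 0 < r) → ∀ t : ℝ, 0 ≤ t →
      HasDerivAt (fun t => c * Real.log (s + t * r)) (c * (r / (s + t * r))) t := by
    intro c s r h t ht
    by_cases hc : c = 0
    · subst hc; simpa using hasDerivAt_const t (0:ℝ)
    · obtain ⟨hs, hr⟩ := h hc
      have hpos : 0 < s + t * r := by positivity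
      have h1 : HasDerivAt (fun t : ℝ => s + t * r) r t := by
        simpa using ((hasDerivAt_id t).mul_const r).const_add s
      exact (h1.log hpos.ne').const_mul c
  have key2 : ∀ c s r : ℝ, (c ≠ 0 → 0 < s ∧ 0 < r) →
      Tendsto (fun t => c * (Real.log (s + t * r) - Real.log t)) atTop (𝓝 (c * Real.log r)) := by
    intro c s r h
    by_cases hc : c = 0
    · subst hc; simp
    · obtain ⟨hs, hr⟩ := h hc
      refine Tendsto.const_mul c ?_
      have h1 : Tendsto (fun t : ℝ => s / t + r) atTop (𝓝 r) := by
        simpa using (tendsto_const_nhds (x := s)).div_atTop tendsto_id |>.add_const r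
      refine (h1.log hr.ne').congr' ?_
      filter_upwards [eventually_gt_atTop 0] with t ht
      rw [← Real.log_div (by positivity) ht.ne']
      congr 1
      field_simp
  set H : ℝ → ℝ := fun t => ∑ k, c k * Real.log (s k + t * r k) -
    ∑ k, c' k * Real.log (s' k + t * r' k) with hH
  have hd : ∀ t, 0 ≤ t → HasDerivAt H (∑ k, c k * (r k / (s k + t * r k)) -
      ∑ k, c' k * (r' k / (s' k + t * r' k))) t := by
    intro t ht
    exact (HasDerivAt.fun_sum fun k _ => key _ _ _ (h k) t ht).sub
      (HasDerivAt.fun_sum fun k _ => key _ _ _ (h' k) t ht)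
  have hmono : MonotoneOn H (Set.Ici 0) := by
    apply monotoneOn_of_deriv_nonneg (convex_Ici 0)
    · intro t ht; exact (hd t ht).continuousAt.continuousWithinAt
    · rw [interior_Ici]; intro t ht
      exact (hd t (le_of_lt ht)).differentiableAt.differentiableWithinAt
    · rw [interior_Ici]; intro t ht
      rw [(hd t (le_of_lt ht)).deriv, sub_nonneg]
      exact hG t ht
  have hlim : Tendsto H atTop (𝓝 (∑ k, c k * Real.log (r k) - ∑ k, c' k * Real.log (r' k))) := by
    have h1 := (tendsto_finsetSum Finset.univ fun k _ => key2 _ _ _ (h k)).sub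
      (tendsto_finsetSum Finset.univ fun k _ => key2 _ _ _ (h' k))
    refine h1.congr fun t => ?_
    simp only [mul_sub, Finset.sum_sub_distrib, ← Finset.sum_mul, hsum, hH]
    ring
  have h0 : H 0 = ∑ k, c k * Real.log (s k) - ∑ k, c' k * Real.log (s' k) := by simp [hH]
  rw [← h0]
  refine ge_of_tendsto hlim ?_
  filter_upwards [eventually_ge_atTop 0] with t ht
  exact hmono (by simp) ht ht

/-- The quadratic functional whose supremum is the quasi-entropy. -/
noncomputable def Q {m : Type*} [Fintype m] (ρ σ : Matrix m m ℂ) (t : ℝ)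
    (X : Matrix m m ℂ) : ℝ :=
  2 * (trace (ρ * X)).re - (trace (σ * (X * Xᴴ))).re - t * (trace (ρ * (Xᴴ * X))).re

theorem Q_formula {m : Type*} [Fintype m] [DecidableEq m] {ρ σ U V : Matrix m m ℂ} {r s : m → ℝ}
    (hρ : Diag ρ U r) (hσ : Diag σ V s) (t : ℝ) (Y : Matrix m m ℂ) :
    Q ρ σ t (V * Y * Uᴴ) = ∑ i, ∑ j, (2 * r i * ((Uᴴ * V) i j * Y j i).re
      - (s j + t * r i) * Complex.normSq (Y j i)) := by
  have e1 : trace (ρ * (V * Y * Uᴴ)) = ∑ i, ∑ j, (r i : ℂ) * ((Uᴴ * V) i j * Y j i) := by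
    rw [hρ.eq, show U * diagonal (fun i => (r i : ℂ)) * Uᴴ * (V * Y * Uᴴ) =
      U * (diagonal (fun i => (r i : ℂ)) * ((Uᴴ * V) * Y) * Uᴴ) by
        simp only [Matrix.mul_assoc], trace_mul_comm, Matrix.mul_assoc, hρ.left, Matrix.mul_one]
    simp only [trace, diag_apply, diagonal_mul, Matrix.mul_apply (M := Uᴴ * V), Finset.mul_sum]
  have e2 : trace (σ * ((V * Y * Uᴴ) * (V * Y * Uᴴ)ᴴ)) =
      ∑ j, ∑ i, (s j : ℂ) * (Y j i * star (Y j i)) := by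
    rw [hσ.eq]
    simp only [conjTranspose_mul, conjTranspose_conjTranspose]
    rw [show V * diagonal (fun i => (s i : ℂ)) * Vᴴ * (V * Y * Uᴴ * (U * (Yᴴ * Vᴴ))) =
      V * (diagonal (fun i => (s i : ℂ)) * ((Vᴴ * V) * (Y * ((Uᴴ * U) * Yᴴ))) * Vᴴ) by
        simp only [Matrix.mul_assoc], trace_mul_comm, Matrix.mul_assoc _ _ V, hσ.left, hρ.left,
        Matrix.mul_one, Matrix.one_mul, Matrix.one_mul]
    simp only [trace, diag_apply, diagonal_mul, Matrix.mul_apply (M := Y), Finset.mul_sum,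
      conjTranspose_apply]
  have e3 : trace (ρ * ((V * Y * Uᴴ)ᴴ * (V * Y * Uᴴ))) =
      ∑ i, ∑ j, (r i : ℂ) * (star (Y j i) * (Y j i)) := by
    rw [hρ.eq]
    simp only [conjTranspose_mul, conjTranspose_conjTranspose]
    rw [show U * diagonal (fun i => (r i : ℂ)) * Uᴴ * (U * (Yᴴ * Vᴴ) * (V * Y * Uᴴ)) =
      U * (diagonal (fun i => (r i : ℂ)) * ((Uᴴ * U) * (Yᴴ * ((Vᴴ * V) * Y))) * Uᴴ) by
        simp only [Matrix.mul_assoc], trace_mul_comm, Matrix.mul_assoc _ _ U, hσ.left, hρ.left,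
        Matrix.mul_one, Matrix.one_mul, Matrix.one_mul]
    simp only [trace, diag_apply, diagonal_mul, Matrix.mul_apply (M := Yᴴ), Finset.mul_sum,
      conjTranspose_apply]
  rw [Finset.sum_comm] at e2
  rw [Q, e1, e2, e3]
  simp only [Complex.re_sum, Complex.re_ofReal_mul, Finset.mul_sum, ← Finset.sum_sub_distrib]
  refine Finset.sum_congr rfl fun i _ => ?_
  refine Finset.sum_congr rfl fun j _ => ?_
  have a1 : (Y j i * star (Y j i)).re = Complex.normSq (Y j i) := by
    simp [Complex.normSq_apply]
  have a2 : (star (Y j i) * Y j i).re = Complex.normSq (Y j i) := by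
    simp [Complex.normSq_apply]
  rw [a1, a2]
  ring

/-- quasi-entropy -/
noncomputable def G {m : Type*} [Fintype m] (U V : Matrix m m ℂ) (r s : m → ℝ) (t : ℝ) : ℝ :=
  ∑ i, ∑ j, (r i * Complex.normSq ((Uᴴ * V) i j)) * (r i / (s j + t * r i))

theorem Q_le {m : Type*} [Fintype m] [DecidableEq m] {ρ σ U V : Matrix m m ℂ} {r s : m → ℝ}
    (hρ : Diag ρ U r) (hσ : Diag σ V s) (hr : ∀ i, 0 ≤ r i) (hs : ∀ i, 0 ≤ s i)
    {t : ℝ} (ht : 0 < t) (X : Matrix m m ℂ) : Q ρ σ t X ≤ G U V r s t := by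
  have : X = V * (Vᴴ * X * U) * Uᴴ := by
    rw [show V * (Vᴴ * X * U) * Uᴴ = (V * Vᴴ) * X * (U * Uᴴ) by simp only [Matrix.mul_assoc],
      hρ.right, hσ.right]; simp
  rw [this, Q_formula hρ hσ, G]
  refine Finset.sum_le_sum fun i _ => Finset.sum_le_sum fun j _ => ?_
  generalize (Vᴴ * X * U) j i = y
  generalize (Uᴴ * V) i j = w
  rcases (hr i).eq_or_lt with h0 | h0
  · rw [← h0]; simp
    exact mul_nonneg (hs j) (Complex.normSq_nonneg _)
  · have hp : 0 < s j + t * r i := by have := hs j; positivity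
    rw [← mul_div_assoc, le_div_iff₀ hp]
    simp only [Complex.normSq_apply, Complex.mul_re]
    nlinarith [sq_nonneg (r i * w.re - (s j + t * r i) * y.re),
      sq_nonneg (r i * w.im + (s j + t * r i) * y.im)]

theorem exists_Q {m : Type*} [Fintype m] [DecidableEq m] {ρ σ U V : Matrix m m ℂ} {r s : m → ℝ}
    (hρ : Diag ρ U r) (hσ : Diag σ V s) (hr : ∀ i, 0 ≤ r i) (hs : ∀ i, 0 ≤ s i)
    {t : ℝ} (ht : 0 < t) : ∃ X, Q ρ σ t X = G U V r s t := by
  refine ⟨V * (Matrix.of fun j i => ((r i / (s j + t * r i) : ℝ) : ℂ) * star ((Uᴴ * V) i j)) * Uᴴ, ?_⟩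
  rw [Q_formula hρ hσ, G]
  refine Finset.sum_congr rfl fun i _ => Finset.sum_congr rfl fun j _ => ?_
  rw [Matrix.of_apply]
  generalize (Uᴴ * V) i j = w
  rcases (hr i).eq_or_lt with h0 | h0
  · rw [← h0]; simp
  · have hp : 0 < s j + t * r i := by have := hs j; positivity
    have : r i = (r i / (s j + t * r i)) * (s j + t * r i) :=
      (div_mul_cancel₀ _ hp.ne').symm
    set a := r i / (s j + t * r i) with ha
    have e1 : (w * ((a : ℂ) * star w)).re = a * Complex.normSq w := by
      simp [Complex.normSq_apply]; ring
    have e2 : Complex.normSq ((a : ℂ) * star w) = a ^ 2 * Complex.normSq w := by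
      simp [Complex.normSq_apply]; ring
    rw [e1, e2]
    linear_combination a * Complex.normSq w * this

end EA
namespace EA

open Matrix
open scoped Kronecker

/-- trace out the right factor -/
def trR {α β : Type*} [Fintype β] (τ : Matrix (α × β) (α × β) ℂ) : Matrix α α ℂ :=
  fun x x' => ∑ y, τ (x, y) (x', y)

/-- trace out the left factor -/
def trL {α β : Type*} [Fintype α] (τ : Matrix (α × β) (α × β) ℂ) : Matrix β β ℂ :=
  fun y y' => ∑ x, τ (x, y) (x, y')

theorem trR_psd {α β : Type*} [Fintype α] [Fintype β] {τ : Matrix (α × β) (α × β) ℂ}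
    (h : τ.PosSemidef) : (trR τ).PosSemidef := by
  have : trR τ = ∑ y, τ.submatrix (fun x => (x, y)) (fun x => (x, y)) := by
    ext x x'; simp [trR, Matrix.sum_apply]
  rw [this]
  exact Matrix.posSemidef_sum _ fun y _ => h.submatrix _

theorem trL_psd {α β : Type*} [Fintype α] [Fintype β] {τ : Matrix (α × β) (α × β) ℂ}
    (h : τ.PosSemidef) : (trL τ).PosSemidef := by
  have : trL τ = ∑ x, τ.submatrix (fun y => (x, y)) (fun y => (x, y)) := by
    ext x x'; simp [trL, Matrix.sum_apply]
  rw [this]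
  exact Matrix.posSemidef_sum _ fun y _ => h.submatrix _

theorem trace_trR {α β : Type*} [Fintype α] [Fintype β] [DecidableEq β]
    (τ : Matrix (α × β) (α × β) ℂ) (X : Matrix α α ℂ) :
    trace (trR τ * X) = trace (τ * (X ⊗ₖ (1 : Matrix β β ℂ))) := by
  simp only [trace, diag_apply, Matrix.mul_apply, trR, kroneckerMap_apply, Fintype.sum_prod_type,
    Matrix.one_apply, mul_ite, mul_one, mul_zero, Finset.sum_ite_eq', Finset.mem_univ, if_true,
    Finset.sum_mul]
  refine Finset.sum_congr rfl fun x _ => ?_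
  rw [Finset.sum_comm]

theorem trace_trL {α β : Type*} [Fintype α] [Fintype β] [DecidableEq α]
    (τ : Matrix (α × β) (α × β) ℂ) (X : Matrix β β ℂ) :
    trace (trL τ * X) = trace (τ * ((1 : Matrix α α ℂ) ⊗ₖ X)) := by
  simp only [trace, diag_apply, Matrix.mul_apply, trL, kroneckerMap_apply, Fintype.sum_prod_type,
    Matrix.one_apply, ite_mul, mul_ite, one_mul, zero_mul, mul_zero, Finset.sum_mul]
  conv_rhs => rw [Finset.sum_comm]
  refine Finset.sum_congr rfl fun y _ => ?_
  rw [Finset.sum_comm]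
  refine Finset.sum_congr rfl fun x _ => ?_
  rw [Finset.sum_comm]
  simp

theorem Q_trR {α β : Type*} [Fintype α] [Fintype β] [DecidableEq α] [DecidableEq β]
    (τ σ : Matrix (α × β) (α × β) ℂ) (t : ℝ) (X : Matrix α α ℂ) :
    Q (trR τ) (trR σ) t X = Q τ σ t (X ⊗ₖ (1 : Matrix β β ℂ)) := by
  simp only [Q, trace_trR, conjTranspose_kronecker, conjTranspose_one, ← mul_kronecker_mul,
    Matrix.one_mul]

theorem Q_submatrix {m k : Type*} [Fintype m] [Fintype k] (e : k ≃ m)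
    (τ σ : Matrix m m ℂ) (t : ℝ) (X : Matrix m m ℂ) :
    Q (τ.submatrix e e) (σ.submatrix e e) t (X.submatrix e e) = Q τ σ t X := by
  have htr : ∀ M : Matrix m m ℂ, trace (M.submatrix e e) = trace M := fun M => by
    simp only [trace, diag_apply, submatrix_apply]
    exact Equiv.sum_comp e (fun i => M i i)
  simp only [Q, conjTranspose_submatrix, submatrix_mul_equiv, htr]

/-- The weights. -/
noncomputable def wt {m : Type*} [Fintype m] (U V : Matrix m m ℂ) (r : m → ℝ) (k : m × m) : ℝ :=
  r k.1 * Complex.normSq ((Uᴴ * V) k.1 k.2)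

theorem wt_nonneg {m : Type*} [Fintype m] (U V : Matrix m m ℂ) (r : m → ℝ) (hr : ∀ i, 0 ≤ r i)
    (k : m × m) : 0 ≤ wt U V r k := mul_nonneg (hr _) (Complex.normSq_nonneg _)

theorem wt_row {m : Type*} [Fintype m] [DecidableEq m] {ρ U V : Matrix m m ℂ} {r : m → ℝ}
    (hρ : Diag ρ U r) (hV : V * Vᴴ = 1) (i : m) : ∑ j, wt U V r (i, j) = r i := by
  simp only [wt, ← Finset.mul_sum]
  have h : (Uᴴ * V) * (Uᴴ * V)ᴴ = 1 := by
    rw [conjTranspose_mul, conjTranspose_conjTranspose,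
      show Uᴴ * V * (Vᴴ * U) = Uᴴ * (V * Vᴴ) * U by simp only [Matrix.mul_assoc], hV,
      Matrix.mul_one, hρ.left]
  have h2 := congrFun (congrFun h i) i
  rw [Matrix.mul_apply, one_apply_eq] at h2
  have h3 : ((∑ j, Complex.normSq ((Uᴴ * V) i j) : ℝ) : ℂ) = 1 := by
    rw [← h2, Complex.ofReal_sum]
    refine Finset.sum_congr rfl fun j _ => ?_
    rw [conjTranspose_apply, Complex.normSq_eq_conj_mul_self, mul_comm]; rfl
  have h4 : (∑ j, Complex.normSq ((Uᴴ * V) i j) : ℝ) = 1 := by exact_mod_cast h3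
  rw [h4, mul_one]

theorem wt_col {m : Type*} [Fintype m] [DecidableEq m] {ρ U V : Matrix m m ℂ} {r : m → ℝ}
    (hρ : Diag ρ U r) (j : m) : ((∑ i, wt U V r (i, j) : ℝ) : ℂ) = (Vᴴ * ρ * V) j j := by
  have h : Vᴴ * ρ * V = (Uᴴ * V)ᴴ * (diagonal (fun i => (r i : ℂ)) * (Uᴴ * V)) := by
    rw [hρ.eq, conjTranspose_mul, conjTranspose_conjTranspose]; simp only [Matrix.mul_assoc]
  rw [h, Matrix.mul_apply, Complex.ofReal_sum]
  refine Finset.sum_congr rfl fun i _ => ?_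
  rw [diagonal_mul, conjTranspose_apply, wt, Complex.ofReal_mul, Complex.normSq_eq_conj_mul_self]
  simp only [← starRingEnd_apply]
  ring

theorem marg_R {α β : Type*} [Fintype α] [Fintype β] [DecidableEq α] [DecidableEq β]
    {τ : Matrix (α × β) (α × β) ℂ} {VA : Matrix α α ℂ} {a : α → ℝ} {VB : Matrix β β ℂ}
    (hA : Diag (trR τ) VA a) (hB : VB * VBᴴ = 1) (x : α) :
    ∑ y, ((VA ⊗ₖ VB)ᴴ * τ * (VA ⊗ₖ VB)) (x, y) (x, y) = (a x : ℂ) := by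
  set D : Matrix α α ℂ := diagonal (Pi.single x 1) with hD
  have h1 : trace (trR τ * (VA * D * VAᴴ)) = (a x : ℂ) := by
    rw [hA.eq, show VA * diagonal (fun i => (a i : ℂ)) * VAᴴ * (VA * D * VAᴴ) =
      VA * (diagonal (fun i => (a i : ℂ)) * (VAᴴ * VA) * D * VAᴴ) by
        simp only [Matrix.mul_assoc], trace_mul_comm, Matrix.mul_assoc _ _ VA, hA.left,
        Matrix.mul_one, Matrix.mul_one, hD, diagonal_mul_diagonal, trace_diagonal]
    simp [Pi.single_apply]
  have h2 : (VA * D * VAᴴ) ⊗ₖ (1 : Matrix β β ℂ) =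
      (VA ⊗ₖ VB) * (D ⊗ₖ 1) * (VA ⊗ₖ VB)ᴴ := by
    rw [conjTranspose_kronecker, ← mul_kronecker_mul, ← mul_kronecker_mul, Matrix.mul_one, hB]
  rw [← h1, trace_trR, h2, ← Matrix.mul_assoc, ← Matrix.mul_assoc, trace_mul_comm,
    ← Matrix.mul_assoc, ← Matrix.mul_assoc, hD,
    show (1 : Matrix β β ℂ) = diagonal (fun _ => 1) from (diagonal_one).symm,
    diagonal_kronecker_diagonal]
  simp only [trace, diag_apply, mul_diagonal, Fintype.sum_prod_type]
  simp [Pi.single_apply]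

theorem marg_L {α β : Type*} [Fintype α] [Fintype β] [DecidableEq α] [DecidableEq β]
    {τ : Matrix (α × β) (α × β) ℂ} {VA : Matrix α α ℂ} {b : β → ℝ} {VB : Matrix β β ℂ}
    (hB : Diag (trL τ) VB b) (hA : VA * VAᴴ = 1) (y : β) :
    ∑ x, ((VA ⊗ₖ VB)ᴴ * τ * (VA ⊗ₖ VB)) (x, y) (x, y) = (b y : ℂ) := by
  set D : Matrix β β ℂ := diagonal (Pi.single y 1) with hD
  have h1 : trace (trL τ * (VB * D * VBᴴ)) = (b y : ℂ) := by
    rw [hB.eq, show VB * diagonal (fun i => (b i : ℂ)) * VBᴴ * (VB * D * VBᴴ) =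
      VB * (diagonal (fun i => (b i : ℂ)) * (VBᴴ * VB) * D * VBᴴ) by
        simp only [Matrix.mul_assoc], trace_mul_comm, Matrix.mul_assoc _ _ VB, hB.left,
        Matrix.mul_one, Matrix.mul_one, hD, diagonal_mul_diagonal, trace_diagonal]
    simp [Pi.single_apply]
  have h2 : (1 : Matrix α α ℂ) ⊗ₖ (VB * D * VBᴴ) =
      (VA ⊗ₖ VB) * (1 ⊗ₖ D) * (VA ⊗ₖ VB)ᴴ := by
    rw [conjTranspose_kronecker, ← mul_kronecker_mul, ← mul_kronecker_mul, Matrix.mul_one, hA]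
  rw [← h1, trace_trL, h2, ← Matrix.mul_assoc, ← Matrix.mul_assoc, trace_mul_comm,
    ← Matrix.mul_assoc, ← Matrix.mul_assoc, hD,
    show (1 : Matrix α α ℂ) = diagonal (fun _ => 1) from (diagonal_one).symm,
    diagonal_kronecker_diagonal]
  simp only [trace, diag_apply, mul_diagonal, Fintype.sum_prod_type]
  simp [Pi.single_apply]

/-- spectral data for mutual information -/
theorem mi_data {α β : Type*} [Fintype α] [Fintype β] [DecidableEq α] [DecidableEq β]
    {τ : Matrix (α × β) (α × β) ℂ} (hτ : τ.PosSemidef) :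
    ∃ (U V : Matrix (α × β) (α × β) ℂ) (r s : α × β → ℝ),
      Diag τ U r ∧ Diag (trR τ ⊗ₖ trL τ) V s ∧ (∀ i, 0 ≤ r i) ∧ (∀ i, 0 ≤ s i) ∧
      (∀ k, wt U V r k ≠ 0 → 0 < s k.2 ∧ 0 < r k.1) ∧
      ((∑ k, wt U V r k : ℝ) : ℂ) = trace τ ∧
      ∑ k, wt U V r k * Real.log (r k.1) = - vnEntropy τ ∧
      ∑ k, wt U V r k * Real.log (s k.2) = - vnEntropy (trR τ) - vnEntropy (trL τ) := by
  obtain ⟨U, r, hU, hr⟩ := exists_diag hτ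
  obtain ⟨VA, a, hA, ha⟩ := exists_diag (trR_psd hτ)
  obtain ⟨VB, b, hB, hb⟩ := exists_diag (trL_psd hτ)
  have hV := hA.kron hB
  have h0 := wt_nonneg U (VA ⊗ₖ VB) r hr
  have hRa : ∀ x, ∑ y, ∑ i, wt U (VA ⊗ₖ VB) r (i, (x, y)) = a x := by
    intro x
    have := marg_R hA hB.right x
    simp only [← wt_col hU] at this
    exact_mod_cast this
  have hLb : ∀ y, ∑ x, ∑ i, wt U (VA ⊗ₖ VB) r (i, (x, y)) = b y := by
    intro y
    have := marg_L hB hA.right y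
    simp only [← wt_col hU] at this
    exact_mod_cast this
  have hsupp : ∀ k, wt U (VA ⊗ₖ VB) r k ≠ 0 → 0 < a k.2.1 ∧ 0 < b k.2.2 ∧ 0 < r k.1 := by
    rintro ⟨i, x, y⟩ hk
    have hpos := lt_of_le_of_ne (h0 _) hk.symm
    refine ⟨?_, ?_, ?_⟩
    · rw [← hRa]
      refine lt_of_lt_of_le hpos ?_
      refine le_trans ?_ (Finset.single_le_sum (f := fun y => ∑ i, wt U (VA ⊗ₖ VB) r (i, (x, y)))
        (fun y _ => Finset.sum_nonneg fun i _ => h0 _) (Finset.mem_univ y))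
      exact Finset.single_le_sum (f := fun i => wt U (VA ⊗ₖ VB) r (i, (x, y)))
        (fun i _ => h0 _) (Finset.mem_univ i)
    · rw [← hLb]
      refine lt_of_lt_of_le hpos ?_
      refine le_trans ?_ (Finset.single_le_sum (f := fun x => ∑ i, wt U (VA ⊗ₖ VB) r (i, (x, y)))
        (fun y _ => Finset.sum_nonneg fun i _ => h0 _) (Finset.mem_univ x))
      exact Finset.single_le_sum (f := fun i => wt U (VA ⊗ₖ VB) r (i, (x, y)))
        (fun i _ => h0 _) (Finset.mem_univ i)
    · refine lt_of_le_of_ne (hr i) fun h => hk ?_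
      simp [wt, ← h]
  refine ⟨U, VA ⊗ₖ VB, r, fun i => a i.1 * b i.2, hU, hV, hr, fun i => mul_nonneg (ha _) (hb _),
    fun k hk => ⟨mul_pos (hsupp k hk).1 (hsupp k hk).2.1, (hsupp k hk).2.2⟩, ?_, ?_, ?_⟩
  · rw [Fintype.sum_prod_type]
    simp only [wt_row hU hV.right]
    rw [hU.eq, trace_mul_comm, ← Matrix.mul_assoc, hU.left, Matrix.one_mul, trace_diagonal]
    simp
  · rw [hU.ent, Fintype.sum_prod_type, neg_neg]
    refine Finset.sum_congr rfl fun i _ => ?_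
    simp only []
    rw [← Finset.sum_mul, wt_row hU hV.right]
  · rw [hA.ent, hB.ent, neg_neg, sub_neg_eq_add]
    have : ∀ k, wt U (VA ⊗ₖ VB) r k * Real.log (a k.2.1 * b k.2.2) =
        wt U (VA ⊗ₖ VB) r k * Real.log (a k.2.1) + wt U (VA ⊗ₖ VB) r k * Real.log (b k.2.2) := by
      intro k
      by_cases hk : wt U (VA ⊗ₖ VB) r k = 0
      · simp [hk]
      · obtain ⟨h1, h2, -⟩ := hsupp k hk
        rw [Real.log_mul h1.ne' h2.ne', mul_add]
    simp only [this, Finset.sum_add_distrib]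
    congr 1
    · rw [Fintype.sum_prod_type, Finset.sum_comm, Fintype.sum_prod_type]
      refine Finset.sum_congr rfl fun x _ => ?_
      simp only [← Finset.sum_mul, hRa]
    · rw [Fintype.sum_prod_type, Finset.sum_comm, Fintype.sum_prod_type, Finset.sum_comm]
      refine Finset.sum_congr rfl fun x _ => ?_
      simp only [← Finset.sum_mul, hLb]

theorem G_eq {m : Type*} [Fintype m] (U V : Matrix m m ℂ) (r s : m → ℝ) (t : ℝ) :
    G U V r s t = ∑ k : m × m, wt U V r k * (r k.1 / (s k.2 + t * r k.1)) := by
  rw [Fintype.sum_prod_type]; rfl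

theorem mi_mono {α β α' β' : Type*} [Fintype α] [Fintype β] [DecidableEq α] [DecidableEq β]
    [Fintype α'] [Fintype β'] [DecidableEq α'] [DecidableEq β']
    {τ : Matrix (α × β) (α × β) ℂ} (hτ : τ.PosSemidef)
    {τ' : Matrix (α' × β') (α' × β') ℂ} (hτ' : τ'.PosSemidef) (htr : trace τ = trace τ')
    (hQ : ∀ (t : ℝ) X', ∃ X, Q τ' (trR τ' ⊗ₖ trL τ') t X' = Q τ (trR τ ⊗ₖ trL τ) t X) :
    vnEntropy (trR τ') + vnEntropy (trL τ') - vnEntropy τ' ≤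
    vnEntropy (trR τ) + vnEntropy (trL τ) - vnEntropy τ := by
  obtain ⟨U, V, r, s, hU, hV, hr, hs, hsupp, hsum, e1, e2⟩ := mi_data hτ
  obtain ⟨U', V', r', s', hU', hV', hr', hs', hsupp', hsum', e1', e2'⟩ := mi_data hτ'
  have := log_mono (wt U V r) (fun k => s k.2) (fun k => r k.1)
    (wt U' V' r') (fun k => s' k.2) (fun k => r' k.1) hsupp hsupp'
    (by rw [htr, ← hsum'] at hsum; exact_mod_cast hsum) (by
      intro t ht
      rw [← G_eq, ← G_eq]
      obtain ⟨X', hX'⟩ := exists_Q hU' hV' hr' hs' ht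
      obtain ⟨X, hX⟩ := hQ t X'
      rw [← hX', hX]
      exact Q_le hU hV hr hs ht X)
  rw [e1, e2, e1', e2'] at this
  linarith

/-- trace out the last of three factors -/
def tr3 {α β γ : Type*} [Fintype γ] (τ : Matrix (α × (β × γ)) (α × (β × γ)) ℂ) :
    Matrix (α × β) (α × β) ℂ :=
  fun x y => ∑ c, τ (x.1, (x.2, c)) (y.1, (y.2, c))

theorem ssa {α β γ : Type*} [Fintype α] [Fintype β] [Fintype γ]
    [DecidableEq α] [DecidableEq β] [DecidableEq γ]
    {τ : Matrix (α × (β × γ)) (α × (β × γ)) ℂ} (hτ : τ.PosSemidef) :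
    vnEntropy τ + vnEntropy (trR (trL τ)) ≤ vnEntropy (tr3 τ) + vnEntropy (trL τ) := by
  set e := Equiv.prodAssoc α β γ with he
  have h3 : tr3 τ = trR (τ.submatrix e e) := rfl
  have hps : (τ.submatrix e e).PosSemidef := hτ.submatrix e
  have hR : trR (tr3 τ) = trR τ := by
    ext x x'; simp only [trR, tr3, Fintype.sum_prod_type]
  have hL : trL (tr3 τ) = trR (trL τ) := by
    ext x x'; simp only [trR, trL, tr3]
    rw [Finset.sum_comm]
  have hσ : trR (tr3 τ) ⊗ₖ trL (tr3 τ) = trR ((trR τ ⊗ₖ trL τ).submatrix e e) := by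
    rw [hR, hL]
    ext ⟨x, y⟩ ⟨x', y'⟩
    simp only [kroneckerMap_apply]
    conv_lhs => rw [trR.eq_def (trL τ)]
    rw [Finset.mul_sum]
    rfl
  have := mi_mono hτ (h3 ▸ trR_psd hps : (tr3 τ).PosSemidef) ?_ ?_
  · rw [hR, hL] at this
    linarith
  · simp only [trace, diag_apply, tr3, Fintype.sum_prod_type]
  · intro t X'
    refine ⟨(X' ⊗ₖ (1 : Matrix γ γ ℂ)).submatrix e.symm e.symm, ?_⟩
    rw [hσ, h3, Q_trR, ← Q_submatrix e τ]
    simp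

end EA
namespace EA

open Matrix
open scoped Kronecker

variable {ι : Type*} [Fintype ι] [DecidableEq ι] {dim : ι → ℕ}

/-- index type -/
abbrev Ind (dim : ι → ℕ) (S : Finset ι) := (i : {j : ι // j ∈ S}) → Fin (dim i.1)

theorem memU1 {S T U : Finset ι} (hU : U = S ∪ T) {i : ι} (h : i ∈ S) : i ∈ U :=
  hU ▸ Finset.mem_union_left _ h
theorem memU2 {S T U : Finset ι} (hU : U = S ∪ T) {i : ι} (h : i ∈ T) : i ∈ U :=
  hU ▸ Finset.mem_union_right _ h
theorem memU3 {S T U : Finset ι} (hU : U = S ∪ T) {i : ι} (h : i ∈ U) (h' : i ∉ S) : i ∈ T :=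
  (Finset.mem_union.1 (hU ▸ h)).resolve_left h'
theorem memC1 {S T : Finset ι} (hT : T = Sᶜ) {i : ι} (h : i ∉ S) : i ∈ T := by
  rw [hT]; simpa using h
theorem memC2 {S T : Finset ι} (hT : T = Sᶜ) {i : ι} (h : i ∈ T) : i ∉ S := by
  rw [hT] at h; simpa using h
theorem memC3 {S T : Finset ι} (hT : T = Sᶜ) {i : ι} (h : i ∉ T) : i ∈ S := by
  rw [hT] at h; simpa using h
theorem memC4 {S T : Finset ι} (hT : T = Sᶜ) {i : ι} (h : i ∈ S) : i ∉ T := by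
  rw [hT]; simpa using h

/-- glue two partial indices -/
def glue {S T U : Finset ι} (hU : U = S ∪ T) (x : Ind dim S) (y : Ind dim T) : Ind dim U :=
  fun i => if h : i.1 ∈ S then x ⟨i.1, h⟩ else
    y ⟨i.1, memU3 hU i.2 h⟩

/-- glue as an equivalence -/
def glueE {S T U : Finset ι} (hU : U = S ∪ T) (hd : Disjoint S T) :
    Ind dim S × Ind dim T ≃ Ind dim U where
  toFun p := glue hU p.1 p.2
  invFun z := (fun i => z ⟨i.1, memU1 hU i.2⟩,
    fun i => z ⟨i.1, memU2 hU i.2⟩)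
  left_inv p := by
    refine Prod.ext ?_ ?_
    · funext i; simp [glue]
    · funext i
      have : i.1 ∉ S := fun h => Finset.disjoint_left.1 hd h i.2
      simp [glue, this]
  right_inv z := by
    funext i
    simp only [glue]
    split_ifs <;> rfl

/-- splitting of the complement -/
def splitE {S T U : Finset ι} (hU : U = S ∪ T) (hd : Disjoint S T) :
    Ind dim T × ((i : {j : ι // j ∉ U}) → Fin (dim i.1)) ≃ ((i : {j : ι // j ∉ S}) → Fin (dim i.1)) where
  toFun p := fun i => if h : i.1 ∈ T then p.1 ⟨i.1, h⟩ else p.2 ⟨i.1, fun h' => h (memU3 hU h' i.2)⟩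
  invFun z := (fun i => z ⟨i.1, fun h => Finset.disjoint_left.1 hd h i.2⟩,
    fun i => z ⟨i.1, fun h => i.2 (memU1 hU h)⟩)
  left_inv p := by
    refine Prod.ext ?_ ?_
    · funext i; simp
    · funext i
      have : i.1 ∉ T := fun h => i.2 (memU2 hU h)
      simp [this]
  right_inv z := by
    funext i
    simp only []
    split_ifs <;> rfl

theorem marginal_trace (ρ : Matrix ((i : ι) → Fin (dim i)) ((i : ι) → Fin (dim i)) ℂ)
    {S T U : Finset ι} (hU : U = S ∪ T) (hd : Disjoint S T) (x x' : Ind dim S) :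
    marginal ρ S x x' = ∑ y, marginal ρ U (glue hU x y) (glue hU x' y) := by
  simp only [marginal]
  rw [← (splitE hU hd).sum_comp, Fintype.sum_prod_type]
  refine Finset.sum_congr rfl fun y _ => Finset.sum_congr rfl fun z _ => ?_
  have : ∀ x : Ind dim S, (fun i => if h : i ∈ S then x ⟨i, h⟩ else (splitE hU hd) (y, z) ⟨i, h⟩ :
      (i : ι) → Fin (dim i)) =
      (fun i => if h : i ∈ U then glue hU x y ⟨i, h⟩ else z ⟨i, h⟩) := by
    intro x
    funext i
    subst hU
    by_cases h1 : i ∈ S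
    · simp [h1, glue]
    · by_cases h2 : i ∈ T
      · simp [h1, h2, glue, splitE]
      · simp [h1, h2, splitE]
  rw [this x, this x']

theorem marginal_psd {ρ : Matrix ((i : ι) → Fin (dim i)) ((i : ι) → Fin (dim i)) ℂ}
    (h : ρ.PosSemidef) (S : Finset ι) : (marginal ρ S).PosSemidef := by
  have : marginal ρ S = ∑ z : (i : {j : ι // j ∉ S}) → Fin (dim i.1),
      ρ.submatrix (fun x : Ind dim S => (fun i => if h : i ∈ S then x ⟨i, h⟩ else z ⟨i, h⟩))
        (fun x : Ind dim S => (fun i => if h : i ∈ S then x ⟨i, h⟩ else z ⟨i, h⟩)) := by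
    ext x x'; simp [marginal, Matrix.sum_apply]
  rw [this]
  exact Matrix.posSemidef_sum _ fun y _ => h.submatrix _

theorem mEnt_ssa {ρ : Matrix ((i : ι) → Fin (dim i)) ((i : ι) → Fin (dim i)) ℂ}
    (hρ : ρ.PosSemidef) {A B C : Finset ι} (hAB : Disjoint A B) (hAC : Disjoint A C)
    (hBC : Disjoint B C) :
    mEnt ρ (A ∪ (B ∪ C)) + mEnt ρ B ≤ mEnt ρ (A ∪ B) + mEnt ρ (B ∪ C) := by
  have hA : Disjoint A (B ∪ C) := Finset.disjoint_union_right.2 ⟨hAB, hAC⟩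
  have hC : Disjoint (A ∪ B) C := Finset.disjoint_union_left.2 ⟨hAC, hBC⟩
  set e1 : Ind dim A × Ind dim (B ∪ C) ≃ Ind dim (A ∪ (B ∪ C)) := glueE rfl hA with he1
  set e2 : Ind dim B × Ind dim C ≃ Ind dim (B ∪ C) := glueE rfl hBC with he2
  set e3 : Ind dim A × Ind dim B ≃ Ind dim (A ∪ B) := glueE rfl hAB with he3
  set e : Ind dim A × (Ind dim B × Ind dim C) ≃ Ind dim (A ∪ (B ∪ C)) :=
    (Equiv.prodCongr (Equiv.refl _) e2).trans e1 with he
  have hp := fun S => marginal_psd hρ S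
  set τ := (marginal ρ (A ∪ (B ∪ C))).submatrix e e with hτ
  have hL : trL τ = (marginal ρ (B ∪ C)).submatrix e2 e2 := by
    ext y y'
    rw [submatrix_apply, marginal_trace ρ (Finset.union_comm A (B ∪ C)) hA.symm]
    refine Finset.sum_congr rfl fun x _ => ?_
    have : ∀ y, e (x, y) = glue (Finset.union_comm A (B ∪ C)) (e2 y) x := by
      intro y
      funext i
      have hi := i.2
      simp only [he, he1, glueE, glue, Equiv.trans_apply, Equiv.coe_fn_mk, Equiv.prodCongr_apply,
        Prod.map]
      by_cases h1 : i.1 ∈ A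
      · have h2 : i.1 ∉ B ∪ C := Finset.disjoint_left.1 hA h1
        rw [dif_pos h1, dif_neg h2]; rfl
      · have h2 : i.1 ∈ B ∪ C := (Finset.mem_union.1 hi).resolve_left h1
        rw [dif_neg h1, dif_pos h2]
    rw [hτ, submatrix_apply, this, this]
  have hB : trR (trL τ) = marginal ρ B := by
    ext y y'
    rw [hL, marginal_trace ρ rfl hBC]
    rfl
  have h3 : tr3 τ = (marginal ρ (A ∪ B)).submatrix e3 e3 := by
    ext y y'
    rw [submatrix_apply, marginal_trace ρ (Finset.union_assoc A B C).symm hC]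
    refine Finset.sum_congr rfl fun c _ => ?_
    have : ∀ y : Ind dim A × Ind dim B, e (y.1, (y.2, c)) =
        glue (Finset.union_assoc A B C).symm (e3 y) c := by
      intro y
      funext i
      simp only [he, he1, he2, he3, glueE, glue, Equiv.trans_apply, Equiv.coe_fn_mk,
        Equiv.prodCongr_apply, Prod.map, Equiv.refl_apply]
      by_cases h1 : i.1 ∈ A
      · simp [h1]
      · by_cases h2 : i.1 ∈ B
        · simp [h1, h2]
        · simp [h1, h2]
    rw [hτ, submatrix_apply, this, this]
  have := ssa (τ := τ) ((hp _).submatrix e)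
  rw [hB, h3, hL, hτ, ent_submatrix _ (hp _).1, ent_submatrix _ (hp _).1,
    ent_submatrix _ (hp _).1] at this
  exact this

theorem mEnt_empty {ρ : Matrix ((i : ι) → Fin (dim i)) ((i : ι) → Fin (dim i)) ℂ}
    (htr : ρ.trace = 1) : mEnt ρ ∅ = 0 := by
  have h1 : marginal ρ ∅ = 1 := by
    ext x y
    obtain rfl : x = y := Subsingleton.elim _ _
    rw [one_apply_eq, ← htr]
    simp only [marginal, trace, diag_apply]
    let e : ((i : ι) → Fin (dim i)) ≃ ((i : {j : ι // j ∉ (∅ : Finset ι)}) → Fin (dim i.1)) :=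
      { toFun := fun z i => z i.1
        invFun := fun z i => z ⟨i, by simp⟩
        left_inv := fun z => rfl
        right_inv := fun z => rfl }
    rw [← e.sum_comp]
    rfl
  have : Diag (marginal ρ ∅) 1 (fun _ => 1) := ⟨by simp, by simp, by simp [h1]⟩
  rw [mEnt, this.ent]
  simp

theorem mEnt_subadd {ρ : Matrix ((i : ι) → Fin (dim i)) ((i : ι) → Fin (dim i)) ℂ}
    (hρ : ρ.PosSemidef) (htr : ρ.trace = 1) {A C : Finset ι} (hAC : Disjoint A C) :
    mEnt ρ (A ∪ C) ≤ mEnt ρ A + mEnt ρ C := by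
  have := mEnt_ssa hρ (A := A) (B := ∅) (C := C) (by simp) hAC (by simp)
  simpa [mEnt_empty htr] using this

theorem mEnt_compl {ρ : Matrix ((i : ι) → Fin (dim i)) ((i : ι) → Fin (dim i)) ℂ}
    (hρ : ρ.PosSemidef) (h1 : ρ.rank = 1) (S T : Finset ι) (hT : T = Sᶜ) :
    mEnt ρ T = mEnt ρ S := by
  obtain ⟨u, w, huw⟩ := rank_one h1
  let e : Ind dim T ≃ ((i : {j : ι // j ∉ S}) → Fin (dim i.1)) :=
    { toFun := fun z i => z ⟨i.1, memC1 hT i.2⟩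
      invFun := fun z i => z ⟨i.1, memC2 hT i.2⟩
      left_inv := fun z => rfl
      right_inv := fun z => rfl }
  let e' : Ind dim S ≃ ((i : {j : ι // j ∉ T}) → Fin (dim i.1)) :=
    { toFun := fun z i => z ⟨i.1, memC3 hT i.2⟩
      invFun := fun z i => z ⟨i.1, memC4 hT i.2⟩
      left_inv := fun z => rfl
      right_inv := fun z => rfl }
  let g : Ind dim S → Ind dim T → ((i : ι) → Fin (dim i)) := fun x z i =>
    if h : i ∈ S then x ⟨i, h⟩ else e z ⟨i, h⟩
  have hg : ∀ x z, (fun i => if h : i ∈ T then z ⟨i, h⟩ else e' x ⟨i, h⟩) = g x z := by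
    intro x z; funext i
    by_cases h : i ∈ S
    · have h' : i ∉ T := by rw [hT]; simpa using h
      simp only [g]; rw [dif_pos h, dif_neg h']; rfl
    · have h' : i ∈ T := by rw [hT]; simpa using h
      simp only [g]; rw [dif_neg h, dif_pos h']; rfl
  let M : Matrix (Ind dim S) (Ind dim T) ℂ := fun x z => u (g x z)
  let N : Matrix (Ind dim T) (Ind dim S) ℂ := fun z x => w (g x z)
  have hS : marginal ρ S = M * N := by
    ext x x'
    rw [Matrix.mul_apply]
    simp only [marginal]
    rw [← e.sum_comp]
    exact Finset.sum_congr rfl fun z _ => huw _ _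
  have hTT : (marginal ρ T)ᵀ = N * M := by
    ext x x'
    rw [Matrix.mul_apply, transpose_apply]
    simp only [marginal]
    rw [← e'.sum_comp]
    refine Finset.sum_congr rfl fun z _ => ?_
    rw [hg, hg, huw, mul_comm]
  have hpS := (marginal_psd hρ S).1
  have hpT := (marginal_psd hρ T).1
  rw [mEnt, mEnt, ← ent_transpose hpT, hS, hTT]
  exact ent_mul_comm _ _ (hTT ▸ hpT.transpose) (hS ▸ hpS)

end EA
namespace EA

open Matrix
open scoped Kronecker

theorem marginal_trace_one {ι : Type*} [Fintype ι] [DecidableEq ι] {dim : ι → ℕ}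
    {ρ : Matrix ((i : ι) → Fin (dim i)) ((i : ι) → Fin (dim i)) ℂ}
    (htr : ρ.trace = 1) (S : Finset ι) : (marginal ρ S).trace = 1 := by
  let x : Ind dim (∅ : Finset ι) := fun i => absurd i.2 (Finset.notMem_empty _)
  have h1 : marginal ρ ∅ x x = 1 := by
    rw [← htr]
    simp only [marginal, trace, diag_apply]
    let e : ((i : ι) → Fin (dim i)) ≃ ((i : {j : ι // j ∉ (∅ : Finset ι)}) → Fin (dim i.1)) :=
      { toFun := fun z i => z i.1
        invFun := fun z i => z ⟨i, by simp⟩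
        left_inv := fun z => rfl
        right_inv := fun z => rfl }
    rw [← e.sum_comp]
    rfl
  rw [← h1, marginal_trace ρ (S := ∅) (T := S) (U := S) (by simp) (by simp)]
  rfl

theorem mEnt_prod {ι : Type*} [Fintype ι] [DecidableEq ι] {dim : ι → ℕ}
    {ρ : Matrix ((i : ι) → Fin (dim i)) ((i : ι) → Fin (dim i)) ℂ}
    (hρ : ρ.PosSemidef) (htr : ρ.trace = 1) {S T U : Finset ι} (hU : U = S ∪ T)
    (hd : Disjoint S T) (hS : S ⊆ U) (hT : T ⊆ U)
    (h : ∀ x y, marginal ρ U x y = marginal ρ S (restInd hS x) (restInd hS y) *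
      marginal ρ T (restInd hT x) (restInd hT y)) :
    mEnt ρ U = mEnt ρ S + mEnt ρ T := by
  have hk : (marginal ρ U).submatrix (glueE hU hd) (glueE hU hd) =
      marginal ρ S ⊗ₖ marginal ρ T := by
    ext x y
    rw [submatrix_apply, h, kroneckerMap_apply]
    have h1 : ∀ x : Ind dim S × Ind dim T, restInd hS (glueE hU hd x) = x.1 := fun x =>
      congrArg Prod.fst ((glueE hU hd).symm_apply_apply x)
    have h2 : ∀ x : Ind dim S × Ind dim T, restInd hT (glueE hU hd x) = x.2 := fun x =>
      congrArg Prod.snd ((glueE hU hd).symm_apply_apply x)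
    rw [h1, h1, h2, h2]
  obtain ⟨VA, a, hA, ha⟩ := exists_diag (marginal_psd hρ S)
  obtain ⟨VB, b, hB, hb⟩ := exists_diag (marginal_psd hρ T)
  have hsum : ∀ {m : Type _} [Fintype m] [DecidableEq m] {σ V : Matrix m m ℂ} {s : m → ℝ},
      Diag σ V s → trace σ = 1 → ∑ i, s i = 1 := by
    intro m _ _ σ V s hD h1
    rw [hD.eq, trace_mul_comm, ← Matrix.mul_assoc, hD.left, Matrix.one_mul, trace_diagonal] at h1
    exact_mod_cast h1
  have sA := hsum hA (marginal_trace_one htr S)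
  have sB := hsum hB (marginal_trace_one htr T)
  rw [mEnt, mEnt, mEnt, ← ent_submatrix (glueE hU hd) (marginal_psd hρ U).1, hk,
    (hA.kron hB).ent, hA.ent, hB.ent, ← neg_add]
  congr 1
  rw [Fintype.sum_prod_type]
  have : ∀ x y, a x * b y * Real.log (a x * b y) =
      a x * Real.log (a x) * b y + a x * (b y * Real.log (b y)) := by
    intro x y
    by_cases h1 : a x = 0
    · simp [h1]
    by_cases h2 : b y = 0
    · simp [h2]
    rw [Real.log_mul h1 h2]; ring
  simp only [this, Finset.sum_add_distrib, ← Finset.mul_sum, ← Finset.sum_mul, sA, sB]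
  ring

theorem ent_maxmix {m : Type*} [Fintype m] [DecidableEq m] {K : ℕ} (hK : 1 ≤ K)
    (hc : Fintype.card m = K) {ρ : Matrix m m ℂ} (h : ρ = (K : ℂ)⁻¹ • 1) :
    vnEntropy ρ = Real.log K := by
  have hD : Diag ρ 1 (fun _ => (K : ℝ)⁻¹) := ⟨by simp, by simp, by
    rw [h]; ext i j; simp [Matrix.one_apply, Matrix.diagonal_apply]⟩
  rw [hD.ent]
  have : (K : ℝ) ≠ 0 := by positivity
  simp [hc]
  field_simp

/-- Sum over permutations. -/
noncomputable def PS {n : ℕ} (g : Finset (Fin n) → ℝ) (T : Finset (Fin n)) : ℝ :=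
  ∑ σ : Equiv.Perm (Fin n), g (T.image σ)

theorem PS_card {n : ℕ} (g : Finset (Fin n) → ℝ) {S T : Finset (Fin n)} (h : S.card = T.card) :
    PS g S = PS g T := by
  let e : {x // x ∈ S} ≃ {x // x ∈ T} := Finset.equivOfCardEq h
  let τ : Equiv.Perm (Fin n) := e.extendSubtype
  have hτ : S.image τ = T := by
    apply Finset.eq_of_subset_of_card_le
    · intro x hx
      obtain ⟨y, hy, rfl⟩ := Finset.mem_image.1 hx
      exact e.extendSubtype_mem y hy
    · rw [Finset.card_image_of_injective _ τ.injective, h]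
  unfold PS
  rw [← Equiv.sum_comp (Equiv.mulRight τ)]
  refine Finset.sum_congr rfl fun σ _ => ?_
  rw [← hτ, Finset.image_image]
  rfl

theorem PS_eq {n : ℕ} (g : Finset (Fin n) → ℝ) (T : Finset (Fin n)) :
    (n.choose T.card : ℝ) * PS g T =
      (n.factorial : ℝ) * ∑ I ∈ Finset.powersetCard T.card (Finset.univ : Finset (Fin n)), g I := by
  have h1 : ∑ I ∈ Finset.powersetCard T.card (Finset.univ : Finset (Fin n)), PS g I =
      (n.choose T.card : ℝ) * PS g T := by
    rw [Finset.sum_congr rfl fun I hI => PS_card g (Finset.mem_powersetCard.1 hI).2]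
    simp
  rw [← h1]
  unfold PS
  rw [Finset.sum_comm]
  have h2 : ∀ σ : Equiv.Perm (Fin n),
      ∑ I ∈ Finset.powersetCard T.card (Finset.univ : Finset (Fin n)), g (I.image σ) =
      ∑ I ∈ Finset.powersetCard T.card (Finset.univ : Finset (Fin n)), g I := by
    intro σ
    refine Finset.sum_nbij' (fun I => I.image σ) (fun I => I.image σ.symm) ?_ ?_ ?_ ?_ ?_
    · intro I hI
      simpa [Finset.mem_powersetCard, Finset.card_image_of_injective _ σ.injective] using hI
    · intro I hI
      simpa [Finset.mem_powersetCard, Finset.card_image_of_injective _ σ.symm.injective] using hI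
    · intro I _; simp [Finset.image_image]
    · intro I _; simp [Finset.image_image]
    · intro I _; rfl
  simp only [h2]
  simp [Fintype.card_perm]

theorem concave_seq (n m : ℕ) (hm : 1 ≤ m) (h2 : 2 * m ≤ n) (a : ℕ → ℝ)
    (ha : ∀ k, k + 2 ≤ n → a (k + 2) + a k ≤ 2 * a (k + 1)) :
    ((n : ℝ) - 2 * m) * (a n - a (n - m)) ≤ m * (a (n - m) - a m) := by
  have hD : ∀ i j, i + j + 1 ≤ n → a (i + j + 1) - a (i + j) ≤ a (i + 1) - a i := by
    intro i j
    induction j with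
    | zero => intro _; simp
    | succ j ih =>
      intro h
      have h1 := ih (by omega)
      have h3 := ha (i + j) (by omega)
      rw [show i + (j + 1) + 1 = i + j + 2 by ring, show i + (j + 1) = i + j + 1 by ring]
      linarith
  set p := n - m with hp
  set δ := a (p + 1) - a p with hδ
  have hup : ∀ j, p + j ≤ n → a (p + j) ≤ a p + j * δ := by
    intro j
    induction j with
    | zero => intro _; simp
    | succ j ih =>
      intro h
      have h1 := ih (by omega)
      have h3 := hD p j (by omega)
      rw [show p + (j + 1) = p + j + 1 by ring]; push_cast
      linarith
  have hlo : ∀ j, m + j ≤ p → a m + j * δ ≤ a (m + j) := by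
    intro j
    induction j with
    | zero => intro _; simp
    | succ j ih =>
      intro h
      have h1 := ih (by omega)
      have h3 := hD (m + j) (p - (m + j)) (by omega)
      rw [show m + j + (p - (m + j)) = p by omega] at h3
      rw [show m + (j + 1) = m + j + 1 by ring]; push_cast
      linarith
  have u := hup m (by omega)
  have l := hlo (n - 2 * m) (by omega)
  rw [show p + m = n by omega] at u
  rw [show m + (n - 2 * m) = p by omega, Nat.cast_sub h2] at l
  push_cast at l
  have hn : (0 : ℝ) ≤ (n : ℝ) - 2 * m := by
    have : ((2 * m : ℕ) : ℝ) ≤ n := by exact_mod_cast h2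
    push_cast at this; linarith
  have hm0 : (0 : ℝ) ≤ m := by positivity
  nlinarith [mul_le_mul_of_nonneg_left u hn, mul_le_mul_of_nonneg_left l hm0]

theorem combin (n m : ℕ) (hm : 1 ≤ m) (h2 : 2 * m ≤ n) (g : Finset (Fin n) → ℝ) (L l : ℝ)
    (hsub : ∀ (T : Finset (Fin n)) (a b : Fin n), a ∉ T → b ∉ T → a ≠ b →
      g (insert a (insert b T)) + g T ≤ g (insert a T) + g (insert b T))
    (h1 : ∀ I : Finset (Fin n), I.card = m → L + g Iᶜ ≤ g I + l)
    (h3 : ∀ I : Finset (Fin n), I.card = m → 2 * L + g Iᶜ ≤ g Finset.univ + g I) :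
    (2 * (n : ℝ) - 3 * m) * L ≤ m * l + ((n : ℝ) - 2 * m) *
      ((∑ I ∈ Finset.powersetCard m (Finset.univ : Finset (Fin n)), g I) / (n.choose m : ℝ)) := by
  let T : ℕ → Finset (Fin n) := fun k => Finset.univ.filter fun i => i.val < k
  have hT : ∀ k, k ≤ n → (T k).card = k := by
    intro k hk
    simp [T, Fin.card_filter_val_lt, hk]
  have hfac : (0 : ℝ) < n.factorial := by exact_mod_cast n.factorial_pos
  have hcard : (∑ _σ : Equiv.Perm (Fin n), (1 : ℝ)) = n.factorial := by
    simp [Fintype.card_perm]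
  have hconc : ∀ k, k + 2 ≤ n →
      PS g (T (k + 2)) + PS g (T k) ≤ 2 * PS g (T (k + 1)) := by
    intro k hk
    let a : Fin n := ⟨k, by omega⟩
    let b : Fin n := ⟨k + 1, by omega⟩
    have haT : a ∉ T k := by simp [T, a]
    have hbT : b ∉ T k := by simp [T, b]
    have hab : a ≠ b := by simp [a, b]
    have e1 : PS g (T (k + 2)) = PS g (insert a (insert b (T k))) := by
      apply PS_card
      rw [hT _ hk, Finset.card_insert_of_notMem (by simp [hab, haT]),
        Finset.card_insert_of_notMem hbT, hT _ (by omega)]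
    have e2 : PS g (T (k + 1)) = PS g (insert a (T k)) := by
      apply PS_card
      rw [hT _ (by omega), Finset.card_insert_of_notMem haT, hT _ (by omega)]
    have e3 : PS g (T (k + 1)) = PS g (insert b (T k)) := by
      apply PS_card
      rw [hT _ (by omega), Finset.card_insert_of_notMem hbT, hT _ (by omega)]
    rw [two_mul]
    nth_rewrite 2 [e3]
    rw [e1, e2]
    simp only [PS, ← Finset.sum_add_distrib]
    refine Finset.sum_le_sum fun σ _ => ?_
    simp only [Finset.image_insert]
    apply hsub
    · simpa using haT
    · simpa using hbT
    · simpa using hab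
  have hc := concave_seq n m hm h2 (fun k => PS g (T k)) hconc
  have hcompl : PS g (T (n - m)) = ∑ σ : Equiv.Perm (Fin n), g ((T m).image σ)ᶜ := by
    rw [PS_card g (T := (T m)ᶜ) (by
      rw [hT _ (by omega), Finset.card_compl, hT _ (by omega)]; simp)]
    unfold PS
    refine Finset.sum_congr rfl fun σ _ => ?_
    congr 1
    ext x
    simp only [Finset.mem_image, Finset.mem_compl]
    constructor
    · rintro ⟨y, hy, rfl⟩ ⟨z, hz, hzy⟩
      exact hy (σ.injective hzy ▸ hz)
    · intro h
      exact ⟨σ.symm x, fun hx => h ⟨_, hx, by simp⟩, by simp⟩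
  have huniv : PS g (T n) = ∑ σ : Equiv.Perm (Fin n), g Finset.univ := by
    unfold PS
    refine Finset.sum_congr rfl fun σ _ => ?_
    have : T n = Finset.univ := by ext i; simp [T]
    rw [this, Finset.image_univ_of_surjective σ.surjective]
  have hTm : ∀ σ : Equiv.Perm (Fin n), ((T m).image σ).card = m := fun σ => by
    rw [Finset.card_image_of_injective _ σ.injective, hT _ (by omega)]
  have k1 : n.factorial * L + PS g (T (n - m)) ≤ PS g (T m) + n.factorial * l := by
    rw [hcompl, ← hcard, Finset.sum_mul, Finset.sum_mul, PS, ← Finset.sum_add_distrib,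
      ← Finset.sum_add_distrib]
    refine Finset.sum_le_sum fun σ _ => ?_
    simpa using h1 _ (hTm σ)
  have k3 : n.factorial * (2 * L) + PS g (T (n - m)) ≤ PS g (T n) + PS g (T m) := by
    rw [hcompl, huniv, ← hcard, Finset.sum_mul, PS, ← Finset.sum_add_distrib,
      ← Finset.sum_add_distrib]
    refine Finset.sum_le_sum fun σ _ => ?_
    simpa using h3 _ (hTm σ)
  have hch : (0 : ℝ) < n.choose m := by exact_mod_cast Nat.choose_pos (by omega)
  have hf : PS g (T m) = n.factorial *
      ((∑ I ∈ Finset.powersetCard m (Finset.univ : Finset (Fin n)), g I) / (n.choose m : ℝ)) := by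
    have := PS_eq g (T m)
    rw [hT _ (by omega)] at this
    field_simp
    linarith
  set f := (∑ I ∈ Finset.powersetCard m (Finset.univ : Finset (Fin n)), g I) / (n.choose m : ℝ)
  have hn : (0 : ℝ) ≤ (n : ℝ) - 2 * m := by
    have : ((2 * m : ℕ) : ℝ) ≤ n := by exact_mod_cast h2
    push_cast at this; linarith
  have hm0 : (0 : ℝ) ≤ m := by positivity
  rw [hf] at k1 k3 hc
  have w1 := mul_le_mul_of_nonneg_left k1 hm0
  have w3 := mul_le_mul_of_nonneg_left k3 hn
  refine le_of_mul_le_mul_left ?_ hfac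
  nlinarith [w1, w3, hc]

theorem ar2 {L S gI gJ SB SA SIB : ℝ} (hL : S = L) (h1 : SIB ≤ gI + SB)
    (h2 : SIB = S + SA + gJ) : L + gJ ≤ gI + (SB - SA) := by linarith

theorem ar3 {L S gI gJ SB SA SIB SRB SXA gU : ℝ} (hL : S = L) (h1 : SIB ≤ gI + SB)
    (h2 : SIB = S + SA + gJ) (h3 : SRB = S + SB) (h4 : SRB = SXA) (h5 : SXA ≤ gU + SA) :
    2 * L + gJ ≤ gU + gI := by linarith

theorem setA {α β : Type*} [DecidableEq α] [DecidableEq β] (T : Finset α) (a b : α) :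
    (insert a (insert b T)).image Sum.inl =
      ({Sum.inl a} : Finset (α ⊕ β)) ∪ (T.image Sum.inl ∪ {Sum.inl b}) := by
  ext i; simp; tauto

theorem setB {α β : Type*} [DecidableEq α] [DecidableEq β] (T : Finset α) (a : α) :
    (insert a T).image Sum.inl = ({Sum.inl a} : Finset (α ⊕ β)) ∪ T.image Sum.inl := by
  ext i; simp

theorem setC {α β : Type*} [DecidableEq α] [DecidableEq β] (T : Finset α) (b : α) :
    (insert b T).image Sum.inl = T.image Sum.inl ∪ ({Sum.inl b} : Finset (α ⊕ β)) := by
  ext i; simp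

end EA
/-- qubit-ebit Singleton bound, piecewise-linear part
(`2(d-1) ≥ n`): `log K ≤ ((n-d+1)/(3d-3-n)) (ℓ + (2d-2-n) σ̿)`.
Systems: `R = Sum.inr 0`, `A_f = Sum.inr 1`, `B_in = Sum.inr 2`. -/
theorem ea_piecewise_linear_bound
    (n d q K : ℕ) (hd : 2 ≤ d) (hdn : d ≤ n) (hdn2 : n ≤ 2 * (d - 1))
    (hq : 2 ≤ q) (hK : 1 ≤ K)
    (dim : Fin n ⊕ Fin 3 → ℕ)
    (hdimX : ∀ i : Fin n, dim (Sum.inl i) = q)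
    (hdimR : dim (Sum.inr 0) = K)
    (ψ : Matrix ((i : Fin n ⊕ Fin 3) → Fin (dim i))
                ((i : Fin n ⊕ Fin 3) → Fin (dim i)) ℂ)
    (hpsd : ψ.PosSemidef) (htr : ψ.trace = 1) (hpure : ψ.rank = 1)
    (hmaxmix : marginal ψ ({Sum.inr 0} : Finset (Fin n ⊕ Fin 3)) = (K : ℂ)⁻¹ • 1)
    (hprod : ∀ x y, marginal ψ ({Sum.inr 0, Sum.inr 2} : Finset (Fin n ⊕ Fin 3)) x y =
      marginal ψ ({Sum.inr 0} : Finset (Fin n ⊕ Fin 3))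
          (restInd (by simp) x) (restInd (by simp) y) *
        marginal ψ ({Sum.inr 2} : Finset (Fin n ⊕ Fin 3))
          (restInd (by simp) x) (restInd (by simp) y))
    (hdec : ∀ I J : Finset (Fin n), Disjoint I J → I ∪ J = Finset.univ →
      I.card = n - d + 1 → J.card = d - 1 →
      mEnt ψ (I.image Sum.inl ∪ ({Sum.inr 2} : Finset (Fin n ⊕ Fin 3))) =
        mEnt ψ ({Sum.inr 0} : Finset (Fin n ⊕ Fin 3)) + mEnt ψ ({Sum.inr 1} : Finset (Fin n ⊕ Fin 3)) + mEnt ψ (J.image Sum.inl)) :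
    Real.log K
      ≤ (((n : ℝ) - d + 1) / (3 * (d : ℝ) - 3 - n)) *
        ((mEnt ψ ({Sum.inr 2} : Finset (Fin n ⊕ Fin 3)) - mEnt ψ ({Sum.inr 1} : Finset (Fin n ⊕ Fin 3)))
          + (2 * (d : ℝ) - 2 - n) *
            ((1 / ((n : ℝ) - d + 1)) * ((∑ I ∈ Finset.powersetCard (n - d + 1) (Finset.univ : Finset (Fin n)),
            mEnt ψ (I.image Sum.inl)) / (n.choose (n - d + 1) : ℝ)))) := by
  have hL : mEnt ψ ({Sum.inr 0} : Finset (Fin n ⊕ Fin 3)) = Real.log K := by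
    apply EA.ent_maxmix hK _ hmaxmix
    rw [Fintype.card_pi]
    simp only [Fintype.card_fin]
    rw [Fintype.prod_eq_single (⟨Sum.inr 0, by simp⟩ : {j // j ∈ ({Sum.inr 0} : Finset (Fin n ⊕ Fin 3))})]
    · exact hdimR
    · intro x hx
      exact absurd (Subtype.ext (Finset.mem_singleton.1 x.2)) hx
  have hRB := EA.mEnt_prod hpsd htr (S := {Sum.inr 0}) (T := {Sum.inr 2})
    (U := {Sum.inr 0, Sum.inr 2}) (by rfl) (by simp) (by simp) (by simp) hprod
  have hcompl := EA.mEnt_compl hpsd hpure ({Sum.inr 0, Sum.inr 2} : Finset (Fin n ⊕ Fin 3))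
    ((Finset.univ : Finset (Fin n)).image Sum.inl ∪ {Sum.inr 1}) (by
      ext i
      rcases i with i | i
      · simp
      · fin_cases i <;> simp)
  have hXA := EA.mEnt_subadd hpsd htr (A := (Finset.univ : Finset (Fin n)).image Sum.inl)
    (C := {Sum.inr 1}) (by simp)
  set m := n - d + 1 with hm
  have hIB : ∀ I : Finset (Fin n), mEnt ψ (I.image Sum.inl ∪ ({Sum.inr 2} : Finset (Fin n ⊕ Fin 3)))
      ≤ mEnt ψ (I.image Sum.inl) + mEnt ψ ({Sum.inr 2} : Finset (Fin n ⊕ Fin 3)) := fun I =>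
    EA.mEnt_subadd hpsd htr (by simp)
  have hdec' : ∀ I : Finset (Fin n), I.card = m →
      mEnt ψ (I.image Sum.inl ∪ ({Sum.inr 2} : Finset (Fin n ⊕ Fin 3))) =
        mEnt ψ ({Sum.inr 0} : Finset (Fin n ⊕ Fin 3)) +
        mEnt ψ ({Sum.inr 1} : Finset (Fin n ⊕ Fin 3)) + mEnt ψ (Iᶜ.image Sum.inl) := fun I hI =>
    hdec I Iᶜ disjoint_compl_right (by simp) hI (by
      rw [Finset.card_compl, hI, Fintype.card_fin]; omega)
  have key := EA.combin n m (by omega) (by omega) (fun T => mEnt ψ (T.image Sum.inl))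
    (Real.log K) (mEnt ψ ({Sum.inr 2} : Finset (Fin n ⊕ Fin 3))
      - mEnt ψ ({Sum.inr 1} : Finset (Fin n ⊕ Fin 3))) ?_ ?_ ?_
  · have hmR : (m : ℝ) = n - d + 1 := by
      rw [hm]; push_cast [Nat.cast_sub hdn]; ring
    have hpos : (0 : ℝ) < m := by rw [hm]; positivity
    have hden : (0 : ℝ) < 3 * (d : ℝ) - 3 - n := by
      have : ((n + 3 + 1 : ℕ) : ℝ) ≤ ((3 * d : ℕ) : ℝ) := by exact_mod_cast (by omega)
      push_cast at this; linarith
    rw [← hmR, div_mul_eq_mul_div, le_div_iff₀ hden]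
    refine le_trans (le_of_eq ?_) (key.trans (le_of_eq ?_))
    · rw [hmR]; ring
    · have e : 2 * (d : ℝ) - 2 - n = n - 2 * m := by rw [hmR]; ring
      rw [e]
      field_simp
  · intro T a b ha hb hab
    have := EA.mEnt_ssa hpsd (A := {Sum.inl a}) (B := T.image Sum.inl) (C := {Sum.inl b})
      (by simpa using ha) (by simpa using hab) (by simpa using hb)
    have e1 := EA.setA (α := Fin n) (β := Fin 3) T a b
    have e2 := EA.setB (α := Fin n) (β := Fin 3) T a
    have e3 := EA.setC (α := Fin n) (β := Fin 3) T b
    change mEnt ψ ((insert a (insert b T)).image Sum.inl) + mEnt ψ (T.image Sum.inl) ≤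
      mEnt ψ ((insert a T).image Sum.inl) + mEnt ψ ((insert b T).image Sum.inl)
    rw [e1, e2, e3]
    exact this
  · intro I hI
    exact EA.ar2 hL (hIB I) (hdec' I hI)
  · intro I hI
    exact EA.ar3 hL (hIB I) (hdec' I hI) hRB hcompl.symm hXA
end
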